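/- arXiv:2111.01435 — 2 statements merged into one kernel-verified Lean document; each statement's English description precedes it below -/
import Mathlib

section
/- Let s ∈ (1,∞), let α ∈ ℕ^N be a multi-index with |α| = α₁ + ⋯ + α_N > 0, and let s₁, s₂, s₃, s₄ with s₁, s₃ ∈ (1,∞) satisfy 1/s = 1/s₁ + 1/s₂ = 1/s₃ + 1/s₄. Then there exists a constant C, depending only on N, α, s, s₁, s₂, s₃, s₄, such that for all Schwartz functions f, g on ℝ^N: ‖∂^α(fg)‖_{L^s(ℝ^N)} ≤ C ( ‖D^{|α|}f‖_{L^{s₁}(ℝ^N)} ‖g‖_{L^{s₂}(ℝ^N)} + ‖f‖_{L^{s₄}(ℝ^N)} ‖D^{|α|}g‖_{L^{s₃}(ℝ^N)} ). -/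
open MeasureTheory Real
open scoped ENNReal NNReal

noncomputable section

/-- `ℝ^N` with the Euclidean norm. -/
abbrev EN (N : ℕ) := EuclideanSpace ℝ (Fin N)

/-- Partial derivative in the `i`-th coordinate direction. -/
def pdN {N : ℕ} (i : Fin N) (f : EN N → ℝ) (x : EN N) : ℝ :=
  fderiv ℝ f x (EuclideanSpace.single i 1)

/-- Iterated partial derivative `∂ᵢⁿ`. -/
def pdNPow {N : ℕ} (i : Fin N) : ℕ → (EN N → ℝ) → EN N → ℝ
  | 0, f => f
  | n + 1, f => pdN i (pdNPow i n f)

/-- The multi-index partial derivative `∂^α`. -/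
def mpd {N : ℕ} (α : Fin N → ℕ) (f : EN N → ℝ) : EN N → ℝ :=
  (List.finRange N).foldr (fun i g => pdNPow i (α i) g) f

section MaximalFunction

variable {E : Type*} [NormedAddCommGroup E] [NormedSpace ℝ E] [MeasurableSpace E] (μ : Measure E)

/-- The centred Hardy–Littlewood maximal function, where averages over balls are normalised so
that the total mass is the volume of the unit ball. -/
def maximalFn (u : E → ℝ≥0∞) (x : E) : ℝ≥0∞ :=
  ⨆ r : Set.Ioi (0 : ℝ), ∫⁻ y in Metric.closedBall 0 1, u (x + r.1 • y) ∂μ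

theorem lintegral_unitBall_le_maximalFn (u : E → ℝ≥0∞) (x : E) {r : ℝ} (hr : 0 < r) :
    ∫⁻ y in Metric.closedBall 0 1, u (x + r • y) ∂μ ≤ maximalFn μ u x :=
  le_iSup (fun r : Set.Ioi (0 : ℝ) ↦ ∫⁻ y in Metric.closedBall 0 1, u (x + r.1 • y) ∂μ) ⟨r, hr⟩

/-- Marcinkiewicz truncation for the maximal function. -/
theorem maximalFn_le_add {u : E → ℝ≥0∞} (l : ℝ≥0∞) (x : E) :
    maximalFn μ u x ≤ l * μ (Metric.closedBall 0 1) +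
      maximalFn μ ({y | l < u y}.indicator u) x := by
  refine iSup_le fun r ↦ ?_
  calc ∫⁻ y in Metric.closedBall 0 1, u (x + r.1 • y) ∂μ
      ≤ ∫⁻ y in Metric.closedBall 0 1, (l + {y | l < u y}.indicator u (x + r.1 • y)) ∂μ := by
        refine lintegral_mono fun y ↦ ?_
        by_cases hy : l < u (x + r.1 • y)
        · rw [Set.indicator_of_mem (by exact hy)]; exact le_add_self
        · exact (not_lt.1 hy).trans le_self_add
    _ = l * μ (Metric.closedBall 0 1) +
        ∫⁻ y in Metric.closedBall 0 1, {y | l < u y}.indicator u (x + r.1 • y) ∂μ := by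
        rw [lintegral_add_left measurable_const, setLIntegral_const]
    _ ≤ _ := by gcongr; exact lintegral_unitBall_le_maximalFn μ _ x r.2

/-- The constant in the weak type `(1, 1)` maximal inequality. -/
def weakTypeConst : ℝ≥0∞ :=
  ENNReal.ofReal (4 ^ Module.finrank ℝ E) * μ (Metric.closedBall 0 1)

variable [FiniteDimensional ℝ E]

theorem weakTypeConst_ne_top [IsFiniteMeasureOnCompacts μ] : weakTypeConst μ ≠ ⊤ :=
  ENNReal.mul_ne_top ENNReal.ofReal_ne_top (isCompact_closedBall (0 : E) 1).measure_lt_top.ne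

variable [BorelSpace E] [μ.IsAddHaarMeasure]

theorem setLIntegral_closedBall_eq {u : E → ℝ≥0∞} (hu : Measurable u) (x : E) {r : ℝ}
    (hr : 0 < r) :
    ∫⁻ y in Metric.closedBall x r, u y ∂μ =
      ENNReal.ofReal (r ^ Module.finrank ℝ E) *
        ∫⁻ y in Metric.closedBall 0 1, u (x + r • y) ∂μ := by
  have h2 : ∀ y, x + r • y ∈ Metric.closedBall x r ↔ y ∈ Metric.closedBall (0 : E) 1 := by
    intro y
    simp [norm_smul, abs_of_pos hr, hr]
  have h3 : ∫⁻ y in Metric.closedBall x r, u y ∂μ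
      = ∫⁻ z, (Metric.closedBall x r).indicator u (x + z) ∂μ := by
    rw [← lintegral_indicator Metric.isClosed_closedBall.measurableSet, lintegral_add_left_eq_self]
  have hm : Measurable fun z ↦ (Metric.closedBall x r).indicator u (x + z) :=
    (hu.indicator Metric.isClosed_closedBall.measurableSet).comp (measurable_const_add x)
  have h4 := lintegral_map (μ := μ) hm (measurable_const_smul r)
  rw [Measure.map_addHaar_smul μ hr.ne', lintegral_smul_measure, smul_eq_mul] at h4
  have hpos : 0 < r ^ Module.finrank ℝ E := pow_pos hr _
  rw [h3, ← lintegral_indicator Metric.isClosed_closedBall.measurableSet]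
  have h5 : ∀ y, (Metric.closedBall (0 : E) 1).indicator (fun y ↦ u (x + r • y)) y
      = (Metric.closedBall x r).indicator u (x + r • y) := by
    intro y
    by_cases hy : y ∈ Metric.closedBall (0 : E) 1
    · rw [Set.indicator_of_mem hy, Set.indicator_of_mem ((h2 y).2 hy)]
    · rw [Set.indicator_of_notMem hy, Set.indicator_of_notMem (fun h ↦ hy ((h2 y).1 h))]
  simp_rw [h5]
  rw [← h4, ← mul_assoc, ← ENNReal.ofReal_mul hpos.le, abs_of_pos (inv_pos.2 hpos),
    mul_inv_cancel₀ hpos.ne', ENNReal.ofReal_one, one_mul]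

theorem mul_meas_lt_lintegral_unitBall_le {u : E → ℝ≥0∞} (hu : Measurable u) (l : ℝ≥0∞) (R : ℝ) :
    l * μ {x | ∃ r ∈ Set.Ioc 0 R, l < ∫⁻ y in Metric.closedBall 0 1, u (x + r • y) ∂μ} ≤
      weakTypeConst μ * ∫⁻ y, u y ∂μ := by
  set A := {x | ∃ r ∈ Set.Ioc 0 R, l < ∫⁻ y in Metric.closedBall 0 1, u (x + r • y) ∂μ}
  choose! ρ hρ hlt using fun x (hx : x ∈ A) ↦ hx
  obtain ⟨s, hsA, hdisj, hcov⟩ := Vitali.exists_disjoint_subfamily_covering_enlargement_closedBall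
    A id ρ R (fun a ha ↦ (hρ a ha).2) 4 (by norm_num)
  have hdisj' : s.PairwiseDisjoint fun a ↦ Metric.closedBall a (ρ a) := hdisj
  have hcount : s.Countable := hdisj.countable_of_nonempty_interior fun i hi ↦
    ⟨i, Metric.ball_subset_interior_closedBall (Metric.mem_ball_self (hρ i (hsA hi)).1)⟩
  have hball : ∀ a ∈ s, l * μ (Metric.closedBall a (4 * ρ a)) ≤
      weakTypeConst μ * ∫⁻ y in Metric.closedBall a (ρ a), u y ∂μ := by
    intro a ha
    have hpos := (hρ a (hsA ha)).1
    rw [setLIntegral_closedBall_eq μ hu a hpos, Measure.addHaar_closedBall' μ a (by positivity),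
      mul_pow, ENNReal.ofReal_mul (by positivity), weakTypeConst]
    calc _ = ENNReal.ofReal (4 ^ Module.finrank ℝ E) * μ (Metric.closedBall 0 1) *
          (ENNReal.ofReal (ρ a ^ Module.finrank ℝ E) * l) := by ring
      _ ≤ _ := by gcongr; exact (hlt a (hsA ha)).le
  have hsub : A ⊆ ⋃ a ∈ s, Metric.closedBall a (4 * ρ a) := by
    intro x hx
    obtain ⟨b, hb, h⟩ := hcov x hx
    exact Set.mem_biUnion hb (h (Metric.mem_closedBall_self (hρ x hx).1.le))
  calc l * μ A ≤ l * ∑' a : s, μ (Metric.closedBall (a : E) (4 * ρ a)) := by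
        gcongr
        exact (measure_mono hsub).trans (measure_biUnion_le μ hcount _)
    _ = ∑' a : s, l * μ (Metric.closedBall (a : E) (4 * ρ a)) := ENNReal.tsum_mul_left.symm
    _ ≤ ∑' a : s, weakTypeConst μ * ∫⁻ y in Metric.closedBall (a : E) (ρ a), u y ∂μ :=
        ENNReal.tsum_le_tsum fun a ↦ hball a a.2
    _ = weakTypeConst μ * ∫⁻ y in ⋃ a ∈ s, Metric.closedBall (a : E) (ρ a), u y ∂μ := by
        rw [ENNReal.tsum_mul_left, lintegral_biUnion hcount
          (fun a _ ↦ Metric.isClosed_closedBall.measurableSet) hdisj']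
    _ ≤ _ := mul_le_mul_right (setLIntegral_le_lintegral _ _) _

/-- The weak type `(1, 1)` inequality for the maximal function. -/
theorem mul_meas_lt_maximalFn_le {u : E → ℝ≥0∞} (hu : Measurable u) (l : ℝ≥0∞) :
    l * μ {x | l < maximalFn μ u x} ≤ weakTypeConst μ * ∫⁻ y, u y ∂μ := by
  have h : {x | l < maximalFn μ u x} = ⋃ n : ℕ, {x | ∃ r ∈ Set.Ioc (0 : ℝ) n,
      l < ∫⁻ y in Metric.closedBall 0 1, u (x + r • y) ∂μ} := by
    ext x
    simp only [maximalFn, lt_iSup_iff, Set.mem_ofPred_eq, Set.mem_iUnion, Subtype.exists]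
    constructor
    · rintro ⟨r, hr, h⟩
      obtain ⟨n, hn⟩ := exists_nat_ge r
      exact ⟨n, r, ⟨hr, hn⟩, h⟩
    · rintro ⟨n, r, hr, h⟩
      exact ⟨r, hr.1, h⟩
  rw [h, Monotone.measure_iUnion, ENNReal.mul_iSup]
  · exact iSup_le fun n ↦ mul_meas_lt_lintegral_unitBall_le μ hu l n
  · rintro a b hab x ⟨r, hr, hx⟩
    exact ⟨r, ⟨hr.1, hr.2.trans (by exact_mod_cast hab)⟩, hx⟩

theorem maximalFn_le_of_ae_le {u : E → ℝ≥0∞} (hu : Measurable u) {a : ℝ≥0∞}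
    (h : ∀ᵐ y ∂μ, u y ≤ a) (x : E) : maximalFn μ u x ≤ a * μ (Metric.closedBall 0 1) := by
  refine iSup_le fun r ↦ ?_
  have hr : 0 < r.1 := r.2
  have h1 : ∫⁻ y in Metric.closedBall x r.1, u y ∂μ ≤ a * μ (Metric.closedBall x r.1) := by
    rw [← setLIntegral_const]
    exact lintegral_mono_ae (ae_restrict_of_ae h)
  rw [setLIntegral_closedBall_eq μ hu x hr, Measure.addHaar_closedBall' μ x hr.le,
    mul_left_comm] at h1
  exact (ENNReal.mul_le_mul_iff_right (by simp [hr]) ENNReal.ofReal_ne_top).1 h1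

theorem mul_meas_lt_maximalFn_le_setLIntegral {u : E → ℝ≥0∞} (hu : Measurable u) (l : ℝ≥0∞) :
    l * μ {x | l * (μ (Metric.closedBall 0 1) + 1) < maximalFn μ u x} ≤
      weakTypeConst μ * ∫⁻ y in {y | l < u y}, u y ∂μ := by
  have hm : MeasurableSet {y | l < u y} := measurableSet_lt measurable_const hu
  rw [← lintegral_indicator hm]
  refine le_trans ?_ (mul_meas_lt_maximalFn_le μ (hu.indicator hm) l)
  refine mul_le_mul_right (measure_mono fun x hx ↦ ?_) _
  have h := lt_of_lt_of_le (show _ < _ from hx) (maximalFn_le_add μ l x)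
  rw [mul_add, mul_one] at h
  exact lt_of_add_lt_add_left h

end MaximalFunction

section MaximalFunctionLp

variable {E : Type*} [NormedAddCommGroup E] [NormedSpace ℝ E] [MeasurableSpace E] (μ : Measure E)

/-- The real-valued version of `maximalFn`. -/
def maximalReal (v : E → ℝ) (x : E) : ℝ :=
  (maximalFn μ (fun y ↦ ENNReal.ofReal (v y)) x).toReal

theorem maximalReal_nonneg (v : E → ℝ) (x : E) : 0 ≤ maximalReal μ v x :=
  ENNReal.toReal_nonneg

variable [BorelSpace E] [FiniteDimensional ℝ E] [μ.IsAddHaarMeasure]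

theorem maximalFn_ofReal_ne_top {v : E → ℝ} (hv : Continuous v) {R : ℝ} (hR : ∀ x, v x ≤ R)
    (x : E) : maximalFn μ (fun y ↦ ENNReal.ofReal (v y)) x ≠ ⊤ := by
  refine ((maximalFn_le_of_ae_le μ hv.measurable.ennreal_ofReal (a := ENNReal.ofReal R)
    (.of_forall fun y ↦ ENNReal.ofReal_le_ofReal (hR y)) x).trans_lt ?_).ne
  exact ENNReal.mul_lt_top ENNReal.ofReal_lt_top (isCompact_closedBall (0 : E) 1).measure_lt_top

theorem ofReal_integral_unitBall {v : E → ℝ} (hv : Continuous v) (h0 : ∀ x, 0 ≤ v x) (x : E)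
    (r : ℝ) : ENNReal.ofReal (∫ y in Metric.closedBall 0 1, v (x + r • y) ∂μ) =
      ∫⁻ y in Metric.closedBall 0 1, ENNReal.ofReal (v (x + r • y)) ∂μ := by
  refine ofReal_integral_eq_lintegral_ofReal ?_ (.of_forall fun y ↦ h0 _)
  exact ContinuousOn.integrableOn_compact (isCompact_closedBall 0 1) (by fun_prop)

theorem integral_unitBall_le_maximalReal {v : E → ℝ} (hv : Continuous v) (h0 : ∀ x, 0 ≤ v x)
    {R : ℝ} (hR : ∀ x, v x ≤ R) (x : E) {r : ℝ} (hr : 0 < r) :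
    ∫ y in Metric.closedBall 0 1, v (x + r • y) ∂μ ≤ maximalReal μ v x := by
  refine (ENNReal.ofReal_le_iff_le_toReal (maximalFn_ofReal_ne_top μ hv hR x)).1 ?_
  rw [ofReal_integral_unitBall μ hv h0]
  exact lintegral_unitBall_le_maximalFn μ (fun y ↦ ENNReal.ofReal (v y)) x hr

theorem measurable_maximalReal {v : E → ℝ} (hv : Continuous v) (h0 : ∀ x, 0 ≤ v x) :
    Measurable (maximalReal μ v) := by
  refine Measurable.ennreal_toReal (LowerSemicontinuous.measurable ?_)
  refine lowerSemicontinuous_iSup fun r ↦ Continuous.lowerSemicontinuous ?_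
  simp_rw [← ofReal_integral_unitBall μ hv h0]
  refine ENNReal.continuous_ofReal.comp ?_
  exact continuous_parametric_integral_of_continuous (f := fun x y ↦ v (x + r.1 • y))
    (by fun_prop) (isCompact_closedBall 0 1)

theorem meas_lt_maximalReal_mul_le {v : E → ℝ} (hv : Continuous v)
    {R : ℝ} (hR : ∀ x, v x ≤ R) {b : ℝ} (hb : ENNReal.ofReal b = μ (Metric.closedBall 0 1) + 1)
    (hb0 : 0 < b) {t : ℝ} (ht : 0 < t) (p : ℝ) :
    μ {x | t < maximalReal μ v x} * ENNReal.ofReal (t ^ (p - 1)) ≤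
      weakTypeConst μ * ENNReal.ofReal b *
        (μ.withDensity (fun y ↦ ENNReal.ofReal (v y)) {x | t < b * v x} *
          ENNReal.ofReal (t ^ (p - 1 - 1))) := by
  have hm : MeasurableSet {x | t < b * v x} :=
    measurableSet_lt measurable_const (by fun_prop)
  have hset : {y | ENNReal.ofReal (t / b) < ENNReal.ofReal (v y)} = {x | t < b * v x} := by
    ext y
    simp only [Set.mem_ofPred_eq]
    rw [ENNReal.ofReal_lt_ofReal_iff_of_nonneg (by positivity), div_lt_iff₀ hb0, mul_comm]
  have hset2 : {x | t < maximalReal μ v x} = {x | ENNReal.ofReal (t / b) *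
      (μ (Metric.closedBall 0 1) + 1) < maximalFn μ (fun y ↦ ENNReal.ofReal (v y)) x} := by
    ext x
    simp only [Set.mem_ofPred_eq]
    rw [← hb, ← ENNReal.ofReal_mul (by positivity), div_mul_cancel₀ _ hb0.ne', maximalReal,
      ENNReal.ofReal_lt_iff_lt_toReal ht.le (maximalFn_ofReal_ne_top μ hv hR x)]
  have key := mul_meas_lt_maximalFn_le_setLIntegral μ hv.measurable.ennreal_ofReal
    (ENNReal.ofReal (t / b))
  rw [hset, ← hset2] at key
  rw [withDensity_apply _ hm]
  have ht2 : t ^ (p - 1) = t / b * (b * t ^ (p - 1 - 1)) := by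
    rw [Real.rpow_sub_one ht.ne' (p - 1)]
    field_simp
  rw [ht2, ENNReal.ofReal_mul (by positivity), ENNReal.ofReal_mul hb0.le]
  calc _ = ENNReal.ofReal (t / b) * μ {x | t < maximalReal μ v x} *
        (ENNReal.ofReal b * ENNReal.ofReal (t ^ (p - 1 - 1))) := by ring
    _ ≤ _ := mul_le_mul_left key _
    _ = _ := by ring

theorem lintegral_maximalReal_rpow_le {p : ℝ} (hp : 1 < p) :
    ∃ C : ℝ≥0∞, C ≠ ⊤ ∧ ∀ (v : E → ℝ) (R : ℝ), Continuous v → (∀ x, 0 ≤ v x) → (∀ x, v x ≤ R) →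
      ∫⁻ x, ENNReal.ofReal (maximalReal μ v x ^ p) ∂μ ≤ C * ∫⁻ x, ENNReal.ofReal (v x ^ p) ∂μ := by
  have hB : μ (Metric.closedBall 0 1) ≠ ⊤ := (isCompact_closedBall (0 : E) 1).measure_lt_top.ne
  set b : ℝ := (μ (Metric.closedBall 0 1) + 1).toReal with hbdef
  have hb : ENNReal.ofReal b = μ (Metric.closedBall 0 1) + 1 := ENNReal.ofReal_toReal (by simp [hB])
  have hb0 : 0 < b := ENNReal.toReal_pos (by simp) (by simp [hB])
  have hp1 : 0 < p - 1 := by linarith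
  refine ⟨ENNReal.ofReal p * (weakTypeConst μ * ENNReal.ofReal b) *
    (ENNReal.ofReal (p - 1))⁻¹ * ENNReal.ofReal (b ^ (p - 1)), ?_, fun v R hv h0 hR ↦ ?_⟩
  · refine ENNReal.mul_ne_top (ENNReal.mul_ne_top (ENNReal.mul_ne_top ENNReal.ofReal_ne_top
      (ENNReal.mul_ne_top (weakTypeConst_ne_top μ) ENNReal.ofReal_ne_top)) ?_) ENNReal.ofReal_ne_top
    simp [hp]
  set ν := μ.withDensity (fun y ↦ ENNReal.ofReal (v y)) with hν
  have h1 := lintegral_rpow_eq_lintegral_meas_lt_mul μ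
    (.of_forall (maximalReal_nonneg μ v)) (measurable_maximalReal μ hv h0).aemeasurable
    (zero_lt_one.trans hp)
  have h2 := lintegral_rpow_eq_lintegral_meas_lt_mul ν (f := fun x ↦ b * v x)
    (.of_forall fun x ↦ mul_nonneg hb0.le (h0 x)) (by fun_prop) hp1
  have h3 : ∫⁻ x, ENNReal.ofReal ((b * v x) ^ (p - 1)) ∂ν =
      ENNReal.ofReal (b ^ (p - 1)) * ∫⁻ x, ENNReal.ofReal (v x ^ p) ∂μ := by
    rw [hν, lintegral_withDensity_eq_lintegral_mul _ hv.measurable.ennreal_ofReal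
      (by fun_prop), ← lintegral_const_mul _ (by fun_prop)]
    refine lintegral_congr fun x ↦ ?_
    rw [Pi.mul_apply, ← ENNReal.ofReal_mul (h0 x), ← ENNReal.ofReal_mul (by positivity),
      Real.mul_rpow hb0.le (h0 x)]
    congr 1
    rcases (h0 x).eq_or_lt with h | h
    · simp [← h, (zero_lt_one.trans hp).ne']
    · rw [Real.rpow_sub_one h.ne']
      field_simp
  rw [h3] at h2
  have h4 : ∫⁻ t in Set.Ioi 0, ν {x | t < b * v x} * ENNReal.ofReal (t ^ (p - 1 - 1)) =
      (ENNReal.ofReal (p - 1))⁻¹ *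
        (ENNReal.ofReal (b ^ (p - 1)) * ∫⁻ x, ENNReal.ofReal (v x ^ p) ∂μ) := by
    rw [h2, ← mul_assoc, ENNReal.inv_mul_cancel (by simp [hp]) ENNReal.ofReal_ne_top, one_mul]
  rw [h1]
  calc _ ≤ ENNReal.ofReal p * ∫⁻ t in Set.Ioi 0, weakTypeConst μ * ENNReal.ofReal b *
        (ν {x | t < b * v x} * ENNReal.ofReal (t ^ (p - 1 - 1))) := by
        refine mul_le_mul_right (setLIntegral_mono' measurableSet_Ioi fun t ht ↦ ?_) _
        exact meas_lt_maximalReal_mul_le μ hv hR hb hb0 ht p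
    _ = _ := by
        rw [lintegral_const_mul' _ _
          (ENNReal.mul_ne_top (weakTypeConst_ne_top μ) ENNReal.ofReal_ne_top), h4]
        ring

/-- The Hardy–Littlewood maximal inequality in `L^p`, `1 < p ≤ ∞`. -/
theorem eLpNorm_maximalReal_le {p : ℝ≥0∞} (hp : 1 < p) :
    ∃ C : ℝ≥0∞, C ≠ ⊤ ∧ ∀ (v : E → ℝ) (R : ℝ), Continuous v → (∀ x, 0 ≤ v x) → (∀ x, v x ≤ R) →
      eLpNorm (maximalReal μ v) p μ ≤ C * eLpNorm v p μ := by
  rcases eq_or_ne p ⊤ with rfl | hp'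
  · refine ⟨μ (Metric.closedBall 0 1), (isCompact_closedBall (0 : E) 1).measure_lt_top.ne,
      fun v R hv h0 hR ↦ ?_⟩
    rw [eLpNorm_exponent_top, eLpNorm_exponent_top, eLpNormEssSup]
    refine essSup_le_of_ae_le _ (.of_forall fun x ↦ ?_)
    beta_reduce
    rw [Real.enorm_of_nonneg (maximalReal_nonneg μ v x), maximalReal,
      ENNReal.ofReal_toReal (maximalFn_ofReal_ne_top μ hv hR x), mul_comm]
    refine maximalFn_le_of_ae_le μ hv.measurable.ennreal_ofReal ?_ x
    filter_upwards [enorm_ae_le_eLpNormEssSup v μ] with y hy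
    rwa [Real.enorm_of_nonneg (h0 y)] at hy
  have hpr : 1 < p.toReal := by
    simpa using (ENNReal.toReal_lt_toReal ENNReal.one_ne_top hp').2 hp
  have hp0 : p ≠ 0 := (zero_lt_one.trans hp).ne'
  obtain ⟨C, hC, h⟩ := lintegral_maximalReal_rpow_le μ hpr
  refine ⟨C ^ (1 / p.toReal), ENNReal.rpow_ne_top_of_nonneg (by positivity) hC,
    fun v R hv h0 hR ↦ ?_⟩
  have hnorm : ∀ w : E → ℝ, (∀ x, 0 ≤ w x) → eLpNorm w p μ =
      (∫⁻ x, ENNReal.ofReal (w x ^ p.toReal) ∂μ) ^ (1 / p.toReal) := by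
    intro w hw
    rw [eLpNorm_eq_lintegral_rpow_enorm_toReal hp0 hp']
    congr 2 with x
    rw [Real.enorm_of_nonneg (hw x), ENNReal.ofReal_rpow_of_nonneg (hw x) (by positivity)]
  rw [hnorm _ (maximalReal_nonneg μ v), hnorm _ h0,
    ← ENNReal.mul_rpow_of_nonneg _ _ (by positivity)]
  exact ENNReal.rpow_le_rpow (h v R hv h0 hR) (by positivity)

end MaximalFunctionLp

section NormEquivalence

theorem exists_norm_le_mul_of_isClosed_cone {V : Type*} [NormedAddCommGroup V] [NormedSpace ℝ V]
    [FiniteDimensional ℝ V] {S : Set V} (hS : IsClosed S) (hsmul : ∀ (c : ℝ), ∀ x ∈ S, c • x ∈ S)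
    {φ : V → ℝ} (hφ : Continuous φ) (h0 : ∀ x, 0 ≤ φ x) (hhom : ∀ (c : ℝ) x, φ (c • x) = |c| * φ x)
    (hdef : ∀ x ∈ S, φ x = 0 → x = 0) : ∃ C : ℝ, 0 < C ∧ ∀ x ∈ S, ‖x‖ ≤ C * φ x := by
  have : ProperSpace V := FiniteDimensional.proper ℝ V
  have hK : IsCompact (S ∩ Metric.sphere 0 1) := (isCompact_sphere 0 1).inter_left hS
  have hunit : ∀ x ∈ S, x ≠ 0 → ‖x‖⁻¹ • x ∈ S ∩ Metric.sphere 0 1 := by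
    intro x hx hx0
    refine ⟨hsmul _ _ hx, ?_⟩
    simp [norm_smul, hx0]
  rcases (S ∩ Metric.sphere 0 1).eq_empty_or_nonempty with h | h
  · refine ⟨1, one_pos, fun x hx ↦ ?_⟩
    have hx0 : x = 0 := by
      by_contra hx0
      simpa [h] using hunit x hx hx0
    simpa [hx0] using h0 0
  · obtain ⟨x₀, hx₀, hmin⟩ := hK.exists_isMinOn h hφ.continuousOn
    have hpos : 0 < φ x₀ := by
      refine (h0 x₀).lt_of_ne fun h ↦ ?_
      have := hdef x₀ hx₀.1 h.symm
      simp [this] at hx₀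
    refine ⟨(φ x₀)⁻¹, inv_pos.2 hpos, fun x hx ↦ ?_⟩
    rcases eq_or_ne x 0 with rfl | hx0
    · simpa using mul_nonneg (inv_nonneg.2 hpos.le) (h0 0)
    · have h1 : φ x₀ ≤ φ (‖x‖⁻¹ • x) := hmin (hunit x hx hx0)
      rw [hhom, abs_of_nonneg (by positivity), ← div_eq_inv_mul,
        le_div_iff₀ (norm_pos_iff.2 hx0)] at h1
      rw [← div_eq_inv_mul, le_div_iff₀ hpos, mul_comm]
      exact h1

theorem eq_zero_of_sum_mul_pow_eq_zero {m : ℕ} {a : Fin m → ℝ}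
    (h : ∀ t ∈ Set.Icc (0 : ℝ) 1, ∑ i, a i * t ^ (i : ℕ) = 0) : a = 0 := by
  have hp : (∑ i, Polynomial.C (a i) * Polynomial.X ^ (i : ℕ) : Polynomial ℝ) = 0 := by
    refine Polynomial.eq_zero_of_infinite_isRoot _ ((Set.Icc_infinite one_pos).mono fun t ht ↦ ?_)
    simpa [Polynomial.IsRoot, Polynomial.eval_finsetSum] using h t ht
  ext i
  have := congrArg (fun q ↦ Polynomial.coeff q (i : ℕ)) hp
  simpa [Polynomial.finsetSum_coeff, Polynomial.coeff_X_pow, Fin.val_inj] using this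

/-- The coefficients of a polynomial are controlled by its `L¹` norm on `[0, 1]`. -/
theorem exists_norm_le_integral_abs_sum_mul_pow (m : ℕ) :
    ∃ C : ℝ, 0 < C ∧ ∀ a : Fin m → ℝ,
      ‖a‖ ≤ C * ∫ t in Set.Icc (0 : ℝ) 1, |∑ i, a i * t ^ (i : ℕ)| := by
  have key := exists_norm_le_mul_of_isClosed_cone (V := Fin m → ℝ) (S := Set.univ) isClosed_univ
    (fun _ _ _ ↦ trivial) (φ := fun a ↦ ∫ t in Set.Icc (0 : ℝ) 1, |∑ i, a i * t ^ (i : ℕ)|)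
    ?_ ?_ ?_ ?_
  · simpa using key
  · exact continuous_parametric_integral_of_continuous
      (f := fun (a : Fin m → ℝ) t ↦ |∑ i, a i * t ^ (i : ℕ)|) (by fun_prop) isCompact_Icc
  · exact fun a ↦ integral_nonneg fun t ↦ abs_nonneg _
  · intro c a
    rw [← integral_const_mul]
    refine integral_congr_ae (.of_forall fun t ↦ ?_)
    simp only [Pi.smul_apply, smul_eq_mul, mul_assoc, ← Finset.mul_sum, abs_mul]
  · intro a _ ha
    have hc : Continuous fun t : ℝ ↦ |∑ i, a i * t ^ (i : ℕ)| := by fun_prop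
    rw [integral_eq_zero_iff_of_nonneg (fun t ↦ abs_nonneg _)
      (hc.continuousOn.integrableOn_compact isCompact_Icc)] at ha
    have h2 := Measure.eqOn_Icc_of_ae_eq volume one_ne_zero.symm ha hc.continuousOn
      continuousOn_const
    exact eq_zero_of_sum_mul_pow_eq_zero fun t ht ↦ abs_eq_zero.1 (h2 ht)

instance continuousMultilinear_finiteDimensional {E : Type*} [NormedAddCommGroup E]
    [NormedSpace ℝ E] [FiniteDimensional ℝ E] (k : ℕ) :
    FiniteDimensional ℝ (E [×k]→L[ℝ] ℝ) :=
  FiniteDimensional.of_injective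
    (ContinuousMultilinearMap.toMultilinearMapLinear :
      (E [×k]→L[ℝ] ℝ) →ₗ[ℝ] MultilinearMap ℝ (fun _ : Fin k ↦ E) ℝ)
    ContinuousMultilinearMap.toMultilinearMap_injective

/-- A symmetric multilinear form is controlled by the `L¹` norm of its diagonal on the unit
ball. -/
theorem exists_norm_le_integral_abs_diagonal {E : Type*} [NormedAddCommGroup E] [NormedSpace ℝ E]
    [MeasurableSpace E] [BorelSpace E] [FiniteDimensional ℝ E] (μ : Measure E)
    [μ.IsAddHaarMeasure] (k : ℕ) :
    ∃ C : ℝ, 0 < C ∧ ∀ T : E [×k]→L[ℝ] ℝ, (∀ (σ : Equiv.Perm (Fin k)) v, T (v ∘ σ) = T v) →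
      ‖T‖ ≤ C * ∫ y in Metric.closedBall 0 1, |T fun _ ↦ y| ∂μ := by
  refine exists_norm_le_mul_of_isClosed_cone
    (S := {T : E [×k]→L[ℝ] ℝ | ∀ (σ : Equiv.Perm (Fin k)) v, T (v ∘ σ) = T v})
    (φ := fun T ↦ ∫ y in Metric.closedBall 0 1, |T fun _ ↦ y| ∂μ) ?_ ?_ ?_ ?_ ?_ ?_
  · simp only [Set.ofPred_forall]
    exact isClosed_iInter fun σ ↦ isClosed_iInter fun v ↦ isClosed_eq
      (ContinuousMultilinearMap.apply ℝ (fun _ ↦ E) ℝ _).continuous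
      (ContinuousMultilinearMap.apply ℝ (fun _ ↦ E) ℝ _).continuous
  · intro c T hT σ v
    simp [hT σ v]
  · refine continuous_parametric_integral_of_continuous
      (f := fun (T : E [×k]→L[ℝ] ℝ) y ↦ |T fun _ ↦ y|) ?_ (isCompact_closedBall 0 1)
    exact (continuous_eval.comp
      (continuous_fst.prodMk (continuous_pi fun _ ↦ continuous_snd))).abs
  · exact fun a ↦ integral_nonneg fun t ↦ abs_nonneg _
  · intro c T
    rw [← integral_const_mul]
    refine integral_congr_ae (.of_forall fun t ↦ ?_)
    simp [abs_mul]
  · intro T hT h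
    have hc : Continuous fun y ↦ |T fun _ ↦ y| :=
      (T.cont.comp (continuous_pi fun _ ↦ continuous_id)).abs
    rw [integral_eq_zero_iff_of_nonneg (fun t ↦ abs_nonneg _)
      (hc.continuousOn.integrableOn_compact (isCompact_closedBall 0 1))] at h
    have h2 := Measure.eqOn_open_of_ae_eq
      (ae_restrict_of_ae_restrict_of_subset Metric.ball_subset_closedBall h)
      Metric.isOpen_ball hc.continuousOn continuousOn_const
    have h3 : (fun y ↦ T fun _ ↦ y) =ᶠ[nhds 0] fun _ ↦ 0 := by
      filter_upwards [Metric.ball_mem_nhds (0 : E) one_pos] with y hy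
      exact abs_eq_zero.1 (h2 hy)
    ext v
    have h4 := T.iteratedFDeriv_comp_diagonal 0 v
    rw [(h3.iteratedFDeriv ℝ k).eq_of_nhds] at h4
    have h5 : ∀ σ : Equiv.Perm (Fin k), T (fun i ↦ v (σ i)) = T v := fun σ ↦ hT σ v
    have h6 : iteratedFDeriv ℝ k (fun _ : E ↦ (0 : ℝ)) 0 = 0 := by
      rw [iteratedFDeriv_fun_zero]; rfl
    rw [h6] at h4
    simpa [h5, Nat.factorial_ne_zero] using h4.symm

end NormEquivalence

section Symmetry

variable {E F : Type*} [NormedAddCommGroup E] [NormedSpace ℝ E] [NormedAddCommGroup F]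
  [NormedSpace ℝ F]

open scoped ContDiff

theorem contDiff_iteratedFDeriv_apply {f : E → F} (hf : ContDiff ℝ ∞ f) (n : ℕ) (v : Fin n → E) :
    ContDiff ℝ ∞ fun x ↦ iteratedFDeriv ℝ n f x v :=
  (ContinuousMultilinearMap.apply ℝ (fun _ : Fin n ↦ E) F v).contDiff.comp
    (hf.iteratedFDeriv_right (m := ∞) (mod_cast le_top))

theorem iteratedFDeriv_succ_apply_eq_fderiv {f : E → F} (hf : ContDiff ℝ ∞ f) (n : ℕ)
    (v : Fin (n + 1) → E) (x : E) :
    iteratedFDeriv ℝ (n + 1) f x v =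
      fderiv ℝ (fun y ↦ iteratedFDeriv ℝ n f y (Fin.tail v)) x (v 0) :=
  DifferentiableAt.iteratedFDeriv_succ_apply_left'
    ((hf.differentiable_iteratedFDeriv (m := n) (by exact_mod_cast WithTop.coe_lt_top n)) x)

theorem iteratedFDeriv_comp_swap {f : E → F} (hf : ContDiff ℝ ∞ f) (n : ℕ) (i : Fin n)
    (v : Fin (n + 1) → E) (x : E) :
    iteratedFDeriv ℝ (n + 1) f x (v ∘ Equiv.swap i.castSucc i.succ) =
      iteratedFDeriv ℝ (n + 1) f x v := by
  induction n generalizing x with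
  | zero => exact i.elim0
  | succ n ih =>
    cases i using Fin.cases with
    | zero =>
      have hw := contDiff_iteratedFDeriv_apply hf n (Fin.tail (Fin.tail v))
      set w := fun y ↦ iteratedFDeriv ℝ n f y (Fin.tail (Fin.tail v)) with hwdef
      have hsymm := (hw.contDiffAt (x := x)).isSymmSndFDerivAt (by
        simpa using WithTop.coe_le_coe.2 (le_top : (2 : ℕ∞) ≤ ⊤))
      have hd : DifferentiableAt ℝ (fderiv ℝ w) x :=
        (hw.fderiv_right (m := ∞) (by simp)).differentiable (by simp) x
      have hexp : ∀ u : Fin (n + 2) → E, Fin.tail (Fin.tail u) = Fin.tail (Fin.tail v) →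
          iteratedFDeriv ℝ (n + 2) f x u = fderiv ℝ (fderiv ℝ w) x (u 0) (u 1) := by
        intro u hu
        rw [iteratedFDeriv_succ_apply_eq_fderiv hf]
        have : (fun y ↦ iteratedFDeriv ℝ (n + 1) f y (Fin.tail u)) =
            fun y ↦ fderiv ℝ w y (u 1) := by
          ext y
          rw [iteratedFDeriv_succ_apply_eq_fderiv hf, hu]
          rfl
        rw [this, fderiv_clm_apply hd (differentiableAt_const _)]
        simp
      rw [hexp v rfl, hexp]
      · simpa using hsymm (v 1) (v 0)
      · ext j
        simp only [Fin.tail, Function.comp_apply]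
        rw [Equiv.swap_apply_of_ne_of_ne]
        · exact (Fin.succ_ne_zero _)
        · intro h
          simp [Fin.ext_iff] at h
    | succ i =>
      rw [iteratedFDeriv_succ_apply_eq_fderiv hf, iteratedFDeriv_succ_apply_eq_fderiv hf]
      have h1 : Fin.tail (v ∘ Equiv.swap i.succ.castSucc i.succ.succ) =
          Fin.tail v ∘ Equiv.swap i.castSucc i.succ := by
        ext j
        simp only [Fin.tail, Function.comp_apply, Fin.castSucc_succ]
        rw [Equiv.swap_apply_def, Equiv.swap_apply_def]
        simp only [Fin.succ_inj]
        split_ifs <;> rfl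
      have h2 : (v ∘ Equiv.swap i.succ.castSucc i.succ.succ) 0 = v 0 := by
        rw [Function.comp_apply, Equiv.swap_apply_of_ne_of_ne]
        · rw [Fin.castSucc_succ]; exact (Fin.succ_ne_zero _).symm
        · exact (Fin.succ_ne_zero _).symm
      simp_rw [h1, h2, ih]

/-- The iterated derivatives of a smooth function are symmetric. -/
theorem iteratedFDeriv_comp_perm_of_contDiff {f : E → F} (hf : ContDiff ℝ ∞ f) {n : ℕ}
    (σ : Equiv.Perm (Fin n)) (v : Fin n → E) (x : E) :
    iteratedFDeriv ℝ n f x (v ∘ σ) = iteratedFDeriv ℝ n f x v := by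
  cases n with
  | zero => congr 1; ext i; exact i.elim0
  | succ n =>
    have hσ : σ ∈ Submonoid.closure
        (Set.range fun i : Fin n ↦ Equiv.swap i.castSucc i.succ) := by
      rw [Equiv.Perm.mclosure_swap_castSucc_succ]; trivial
    induction hσ using Submonoid.closure_induction generalizing v with
    | mem σ h =>
      obtain ⟨i, rfl⟩ := h
      exact iteratedFDeriv_comp_swap hf n i v x
    | one => rfl
    | mul σ τ _ _ h1 h2 =>
      rw [Equiv.Perm.coe_mul, ← Function.comp_assoc, h2, h1]

end Symmetry

section Interpolation

open scoped ContDiff Nat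

/-- Intermediate derivatives at the left endpoint of `[0, 1]` are controlled by the `L¹` norms of
the function and of its `m`-th derivative. -/
theorem exists_abs_iteratedDeriv_zero_le {k m : ℕ} (hkm : k < m) :
    ∃ C > 0, ∀ h : ℝ → ℝ, ContDiff ℝ ∞ h → |iteratedDeriv k h 0| ≤
      C * ((∫ t in Set.Icc (0 : ℝ) 1, |h t|) +
        ∫ t in Set.Icc (0 : ℝ) 1, |iteratedDeriv m h t|) := by
  obtain ⟨C, hC, hCa⟩ := exists_norm_le_integral_abs_sum_mul_pow m
  refine ⟨k ! * C, by positivity, fun h hh ↦ ?_⟩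
  obtain ⟨n, rfl⟩ : ∃ n, m = n + 1 := ⟨m - 1, by omega⟩
  have hcont : ∀ j, Continuous (iteratedDeriv j h) := fun j ↦
    hh.continuous_iteratedDeriv j (mod_cast le_top)
  have hint : ∀ {v : ℝ → ℝ}, Continuous v → IntegrableOn (fun t ↦ |v t|) (Set.Icc 0 1) :=
    fun hv ↦ hv.abs.continuousOn.integrableOn_compact isCompact_Icc
  set a : Fin (n + 1) → ℝ := fun i ↦ (i ! : ℝ)⁻¹ * iteratedDeriv i h 0 with ha
  have hpt : ∀ σ ∈ Set.Icc (0 : ℝ) 1, |∑ i, a i * σ ^ (i : ℕ)| ≤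
      |h σ| + ∫ t in Set.Icc (0 : ℝ) 1, |iteratedDeriv (n + 1) h t| := by
    intro σ hσ
    rcases hσ.1.eq_or_lt with rfl | h0
    · have : ∑ i, a i * (0 : ℝ) ^ (i : ℕ) = h 0 := by
        rw [Fin.sum_univ_succ]; simp [ha]
      rw [this]
      have : 0 ≤ ∫ t in Set.Icc (0 : ℝ) 1, |iteratedDeriv (n + 1) h t| :=
        integral_nonneg fun t ↦ abs_nonneg _
      linarith
    have hu : UniqueDiffOn ℝ (Set.uIcc 0 σ) := uniqueDiffOn_uIcc h0.ne
    have hder : ∀ j, ∀ t ∈ Set.uIcc 0 σ,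
        iteratedDerivWithin j h (Set.uIcc 0 σ) t = iteratedDeriv j h t := fun j t ht ↦
      iteratedDerivWithin_eq_iteratedDeriv hu (hh.contDiffAt.of_le (mod_cast le_top)) ht
    have htaylor := taylor_integral_remainder (f := h) (x₀ := 0) (x := σ) (n := n)
      (hh.contDiffOn.of_le (mod_cast le_top))
    have hsum : taylorWithinEval h n (Set.uIcc 0 σ) 0 σ = ∑ i, a i * σ ^ (i : ℕ) := by
      rw [taylor_within_apply, Finset.sum_range]
      refine Finset.sum_congr rfl fun i _ ↦ ?_
      rw [hder _ _ Set.left_mem_uIcc, sub_zero, smul_eq_mul]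
      ring
    rw [hsum] at htaylor
    have hrem : |∫ t in (0 : ℝ)..σ, ((σ - t) ^ n / n !) •
        iteratedDerivWithin (n + 1) h (Set.uIcc 0 σ) t| ≤
        ∫ t in Set.Icc (0 : ℝ) 1, |iteratedDeriv (n + 1) h t| := by
      rw [intervalIntegral.integral_of_le h0.le, ← norm_eq_abs]
      have hsub : Set.Ioc 0 σ ⊆ Set.Icc (0 : ℝ) 1 := fun t ht ↦ ⟨ht.1.le, ht.2.trans hσ.2⟩
      refine (norm_integral_le_of_norm_le (g := fun t ↦ |iteratedDeriv (n + 1) h t|)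
        ((hint (hcont _)).mono_set hsub) ?_).trans
        (setIntegral_mono_set (hint (hcont _)) (ae_of_all _ fun t ↦ abs_nonneg _)
          hsub.eventuallyLE)
      filter_upwards [ae_restrict_mem measurableSet_Ioc] with t ht
      rw [hder _ _ (Set.mem_uIcc_of_le ht.1.le ht.2), norm_smul, norm_eq_abs, norm_eq_abs]
      refine mul_le_of_le_one_left (abs_nonneg _) ?_
      have h1 : 0 ≤ σ - t := by linarith [ht.2]
      rw [abs_of_nonneg (by positivity)]
      exact div_le_one_of_le₀ ((pow_le_one₀ h1 (by linarith [ht.1, hσ.2])).trans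
        (mod_cast Nat.factorial_pos n)) (by positivity)
    rw [← htaylor] at hrem
    have := abs_sub_abs_le_abs_sub (∑ i, a i * σ ^ (i : ℕ)) (h σ)
    rw [abs_sub_comm] at this
    linarith
  have hmono : ∫ σ in Set.Icc (0 : ℝ) 1, |∑ i, a i * σ ^ (i : ℕ)| ≤
      (∫ t in Set.Icc (0 : ℝ) 1, |h t|) +
        ∫ t in Set.Icc (0 : ℝ) 1, |iteratedDeriv (n + 1) h t| := by
    refine (setIntegral_mono_on (hint (by fun_prop))
      ((hint hh.continuous).add (integrableOn_const (by simp) (by simp)))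
      measurableSet_Icc hpt).trans ?_
    rw [integral_add' (hint hh.continuous) (integrableOn_const (by simp) (by simp))]
    simp
  have hk := (norm_le_pi_norm a ⟨k, hkm⟩).trans (hCa a)
  rw [ha, norm_eq_abs, abs_mul, abs_of_nonneg (by positivity), inv_mul_le_iff₀ (by positivity)]
    at hk
  refine hk.trans ?_
  rw [mul_assoc]
  gcongr

end Interpolation

section PointwiseInterpolation

variable {E : Type*} [NormedAddCommGroup E] [NormedSpace ℝ E]

open scoped ContDiff

theorem iteratedDeriv_comp_add_smul {F : Type*} [NormedAddCommGroup F] [NormedSpace ℝ F]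
    {f : E → F} (hf : ContDiff ℝ ∞ f) (x w : E) (k : ℕ) (σ : ℝ) :
    iteratedDeriv k (fun σ : ℝ ↦ f (x + σ • w)) σ =
      iteratedFDeriv ℝ k f (x + σ • w) fun _ ↦ w := by
  induction k generalizing σ with
  | zero => simp
  | succ k ih =>
    rw [iteratedDeriv_succ, funext ih, iteratedFDeriv_succ_apply_eq_fderiv hf]
    have hd : DifferentiableAt ℝ (fun z ↦ iteratedFDeriv ℝ k f z fun _ ↦ w) (x + σ • w) :=
      (contDiff_iteratedFDeriv_apply hf k _).differentiable (by simp) _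
    have hl : HasDerivAt (fun σ : ℝ ↦ x + σ • w) w σ := by
      simpa using ((hasDerivAt_id σ).smul_const w).const_add x
    exact (hd.hasFDerivAt.comp_hasDerivAt σ hl).deriv

variable [MeasurableSpace E] [BorelSpace E] [FiniteDimensional ℝ E] (μ : Measure E)
  [μ.IsAddHaarMeasure]

theorem integrable_unitBall_prod_Icc {v : E → ℝ} (hv : Continuous v) (x : E) (t : ℝ) :
    Integrable (fun p : E × ℝ ↦ v (x + p.2 • t • p.1))
      ((μ.restrict (Metric.closedBall 0 1)).prod (volume.restrict (Set.Icc (0 : ℝ) 1))) := by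
  have := FiniteDimensional.proper_real E
  rw [Measure.prod_restrict]
  exact (Continuous.continuousOn (by fun_prop)).integrableOn_compact
    ((isCompact_closedBall (0 : E) 1).prod isCompact_Icc)

theorem integral_unitBall_integral_segment_le_maximalReal {v : E → ℝ} (hv : Continuous v)
    (h0 : ∀ x, 0 ≤ v x) {R : ℝ} (hR : ∀ x, v x ≤ R) (x : E) {t : ℝ} (ht : 0 < t) :
    ∫ y in Metric.closedBall (0 : E) 1, (∫ σ in Set.Icc (0 : ℝ) 1, v (x + σ • t • y)) ∂μ ≤
      maximalReal μ v x := by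
  have hint := integrable_unitBall_prod_Icc μ hv x t
  rw [integral_integral_swap hint, integral_Icc_eq_integral_Ioc]
  have hint' := (hint.integral_prod_right).mono_measure
    (Measure.restrict_mono Set.Ioc_subset_Icc_self le_rfl)
  refine (setIntegral_mono_on hint' (integrableOn_const (by simp) (by simp)) measurableSet_Ioc
    fun σ hσ ↦ ?_).trans (b := ∫ σ in Set.Ioc (0 : ℝ) 1, maximalReal μ v x) (by simp)
  simpa only [smul_smul] using
    integral_unitBall_le_maximalReal μ hv h0 hR x (mul_pos hσ.1 ht)

/-- Scale-dependent pointwise interpolation of the intermediate derivatives of a smooth function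
between maximal functions of the function and of its `m`-th derivative. -/
theorem exists_pow_mul_norm_iteratedFDeriv_le {k m : ℕ} (hkm : k < m) :
    ∃ C > 0, ∀ (f : E → ℝ) (R : ℝ), ContDiff ℝ ∞ f → (∀ x, |f x| ≤ R) →
      (∀ x, ‖iteratedFDeriv ℝ m f x‖ ≤ R) → ∀ (x : E) (t : ℝ), 0 < t →
        t ^ k * ‖iteratedFDeriv ℝ k f x‖ ≤
          C * (maximalReal μ (fun y ↦ |f y|) x +
            t ^ m * maximalReal μ (fun y ↦ ‖iteratedFDeriv ℝ m f y‖) x) := by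
  obtain ⟨C₁, hC₁, h₁⟩ := exists_norm_le_integral_abs_diagonal μ k
  obtain ⟨C₂, hC₂, h₂⟩ := exists_abs_iteratedDeriv_zero_le hkm
  refine ⟨C₁ * C₂, by positivity, fun f R hf hR hRm x t ht ↦ ?_⟩
  have := FiniteDimensional.proper_real E
  have hcf : Continuous fun y ↦ |f y| := hf.continuous.abs
  have hcm : Continuous fun y ↦ ‖iteratedFDeriv ℝ m f y‖ :=
    (hf.continuous_iteratedFDeriv (m := m) (mod_cast le_top)).norm
  set U : E → ℝ := fun y ↦ ∫ σ in Set.Icc (0 : ℝ) 1, |f (x + σ • t • y)|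
  set V : E → ℝ := fun y ↦ ∫ σ in Set.Icc (0 : ℝ) 1, ‖iteratedFDeriv ℝ m f (x + σ • t • y)‖
  have hU : IntegrableOn U (Metric.closedBall 0 1) μ :=
    (integrable_unitBall_prod_Icc μ hcf x t).integral_prod_left
  have hV : IntegrableOn V (Metric.closedBall 0 1) μ :=
    (integrable_unitBall_prod_Icc μ hcm x t).integral_prod_left
  have hline : ∀ (j : ℕ) (y : E) (σ : ℝ), iteratedDeriv j (fun σ : ℝ ↦ f (x + σ • t • y)) σ =
      t ^ j * iteratedFDeriv ℝ j f (x + σ • t • y) fun _ ↦ y := fun j y σ ↦ by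
    rw [iteratedDeriv_comp_add_smul hf,
      (iteratedFDeriv ℝ j f (x + σ • t • y)).map_smul_univ (fun _ ↦ t) fun _ ↦ y]
    simp
  have hpt : ∀ y ∈ Metric.closedBall (0 : E) 1, t ^ k * |iteratedFDeriv ℝ k f x fun _ ↦ y| ≤
      C₂ * (U y + t ^ m * V y) := by
    intro y hy
    have hy1 : ‖y‖ ≤ 1 := by simpa using hy
    have h := h₂ (fun σ : ℝ ↦ f (x + σ • t • y)) (by fun_prop)
    simp only [hline, abs_mul, abs_of_pos (pow_pos ht _), zero_smul, add_zero,
      integral_const_mul] at h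
    refine h.trans ?_
    gcongr
    have hdir : Continuous fun σ : ℝ ↦ |iteratedFDeriv ℝ m f (x + σ • t • y) fun _ ↦ y| :=
      ((contDiff_iteratedFDeriv_apply hf m fun _ ↦ y).continuous.comp
        (g := fun z ↦ iteratedFDeriv ℝ m f z fun _ ↦ y)
        (f := fun σ : ℝ ↦ x + σ • t • y) (by fun_prop)).abs
    refine setIntegral_mono hdir.integrableOn_Icc
      (hcm.comp (f := fun σ : ℝ ↦ x + σ • t • y) (by fun_prop)).integrableOn_Icc fun σ ↦ ?_
    dsimp only
    rw [← norm_eq_abs]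
    refine ((iteratedFDeriv ℝ m f _).le_opNorm _).trans ?_
    refine mul_le_of_le_one_right (norm_nonneg _) ?_
    simpa using pow_le_one₀ (norm_nonneg y) hy1
  have hdiag := h₁ (iteratedFDeriv ℝ k f x)
    fun σ v ↦ iteratedFDeriv_comp_perm_of_contDiff hf σ v x
  have hcd : Continuous fun y : E ↦ |iteratedFDeriv ℝ k f x fun _ ↦ y| := by
    have := (iteratedFDeriv ℝ k f x).cont
    exact (this.comp (by fun_prop)).abs
  calc t ^ k * ‖iteratedFDeriv ℝ k f x‖
      ≤ t ^ k * (C₁ * ∫ y in Metric.closedBall (0 : E) 1,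
          |iteratedFDeriv ℝ k f x fun _ ↦ y| ∂μ) := by gcongr
    _ = C₁ * ∫ y in Metric.closedBall (0 : E) 1,
          t ^ k * |iteratedFDeriv ℝ k f x fun _ ↦ y| ∂μ := by
        rw [integral_const_mul]; ring
    _ ≤ C₁ * ∫ y in Metric.closedBall (0 : E) 1, C₂ * (U y + t ^ m * V y) ∂μ := by
        gcongr ?_ * ?_
        exact setIntegral_mono_on ((hcd.continuousOn.integrableOn_compact
          (isCompact_closedBall _ _)).const_mul _) ((hU.add (hV.const_mul _)).const_mul _)
          measurableSet_closedBall hpt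
    _ = C₁ * C₂ * ((∫ y in Metric.closedBall (0 : E) 1, U y ∂μ) +
          t ^ m * ∫ y in Metric.closedBall (0 : E) 1, V y ∂μ) := by
        rw [integral_const_mul, integral_add hU (hV.const_mul _), integral_const_mul]; ring
    _ ≤ _ := by
        gcongr
        · exact integral_unitBall_integral_segment_le_maximalReal μ hcf (fun _ ↦ abs_nonneg _)
            hR x ht
        · exact integral_unitBall_integral_segment_le_maximalReal μ hcm (fun _ ↦ norm_nonneg _)
            hRm x ht

end PointwiseInterpolation

section Product

open scoped ContDiff

theorem le_two_mul_of_forall_mul_le {A B P Q c : ℝ} (hA : 0 ≤ A) (hB : 0 ≤ B) (hP : 0 ≤ P)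
    (hQ : 0 ≤ Q) (h : ∀ τ > 0, τ * c ≤ (A + τ * B) * (P + τ * Q)) :
    c ≤ 2 * (A * Q + B * P) := by
  have hε : ∀ ε > 0, c ≤ 2 * (A * Q + B * P) + ε * (P + Q) := by
    intro ε hε
    have hA' : 0 < A + ε := by linarith
    have hB' : 0 < B + ε := by linarith
    have hτ := h ((A + ε) / (B + ε)) (by positivity)
    rw [div_mul_eq_mul_div, div_le_iff₀ hB'] at hτ
    have e : (A + (A + ε) / (B + ε) * B) * (P + (A + ε) / (B + ε) * Q) * (B + ε) =
        (A + (A + ε) / (B + ε) * B) * (P * (B + ε) + (A + ε) * Q) := by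
      field_simp
    have h1 : (A + ε) / (B + ε) * B ≤ A + ε := by
      rw [div_mul_eq_mul_div, div_le_iff₀ hB']
      nlinarith
    rw [e] at hτ
    have h2 : A * (P * (B + ε)) ≤ (A + ε) * (P * (B + ε)) := by gcongr; linarith
    have h3 : (A + ε) / (B + ε) * B * (P * (B + ε)) = (A + ε) * (B * P) := by field_simp
    have h4 : (A + ε) / (B + ε) * B * ((A + ε) * Q) ≤ (A + ε) * ((A + ε) * Q) := by gcongr
    have h5 : A * ((A + ε) * Q) = (A + ε) * (A * Q) := by ring
    have h6 : (A + ε) * c ≤ (A + ε) * (2 * (A * Q + B * P) + ε * (P + Q)) := by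
      nlinarith
    exact le_of_mul_le_mul_left h6 hA'
  by_contra! hlt
  have hS : 0 < P + Q + 1 := by linarith
  have := hε ((c - 2 * (A * Q + B * P)) / (P + Q + 1)) (div_pos (by linarith) hS)
  have h' : (c - 2 * (A * Q + B * P)) / (P + Q + 1) * (P + Q) < c - 2 * (A * Q + B * P) := by
    rw [div_mul_eq_mul_div, div_lt_iff₀ hS]
    nlinarith
  linarith

variable {E : Type*} [NormedAddCommGroup E] [NormedSpace ℝ E]
  [MeasurableSpace E] (μ : Measure E)

/-- The sum of a function and of its maximal function. -/
def majorant (v : E → ℝ) (x : E) : ℝ := v x + maximalReal μ v x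

theorem le_majorant (v : E → ℝ) (x : E) : v x ≤ majorant μ v x :=
  le_add_of_nonneg_right (maximalReal_nonneg μ v x)

theorem maximalReal_le_majorant {v : E → ℝ} (h0 : ∀ x, 0 ≤ v x) (x : E) :
    maximalReal μ v x ≤ majorant μ v x :=
  le_add_of_nonneg_left (h0 x)

theorem majorant_nonneg {v : E → ℝ} (h0 : ∀ x, 0 ≤ v x) (x : E) : 0 ≤ majorant μ v x :=
  (h0 x).trans (le_majorant μ v x)

variable [BorelSpace E] [FiniteDimensional ℝ E] [μ.IsAddHaarMeasure]

theorem measurable_majorant {v : E → ℝ} (hv : Continuous v) (h0 : ∀ x, 0 ≤ v x) :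
    Measurable (majorant μ v) :=
  hv.measurable.add (measurable_maximalReal μ hv h0)

theorem eLpNorm_majorant_le {p : ℝ≥0∞} (hp : 1 < p) :
    ∃ C : ℝ≥0∞, C ≠ ⊤ ∧ ∀ (v : E → ℝ) (R : ℝ), Continuous v → (∀ x, 0 ≤ v x) →
      (∀ x, v x ≤ R) → eLpNorm (majorant μ v) p μ ≤ C * eLpNorm v p μ := by
  obtain ⟨C, hC, h⟩ := eLpNorm_maximalReal_le μ hp
  refine ⟨1 + C, by simp [hC], fun v R hv h0 hR ↦ ?_⟩
  refine (eLpNorm_add_le hv.aestronglyMeasurable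
    (measurable_maximalReal μ hv h0).aestronglyMeasurable hp.le).trans ?_
  rw [add_mul, one_mul]
  gcongr
  exact h v R hv h0 hR

theorem exists_pow_mul_norm_iteratedFDeriv_le_majorant {k m : ℕ} (hkm : k ≤ m) :
    ∃ C > 0, ∀ (f : E → ℝ) (R : ℝ), ContDiff ℝ ∞ f → (∀ x, |f x| ≤ R) →
      (∀ x, ‖iteratedFDeriv ℝ m f x‖ ≤ R) → ∀ (x : E) (t : ℝ), 0 < t →
        t ^ k * ‖iteratedFDeriv ℝ k f x‖ ≤
          C * (majorant μ (fun y ↦ |f y|) x +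
            t ^ m * majorant μ (fun y ↦ ‖iteratedFDeriv ℝ m f y‖) x) := by
  rcases hkm.eq_or_lt with rfl | hlt
  · refine ⟨1, one_pos, fun f R _ _ _ x t ht ↦ ?_⟩
    rw [one_mul]
    refine le_add_of_nonneg_of_le (majorant_nonneg μ (fun _ ↦ abs_nonneg _) x) ?_
    gcongr
    exact le_majorant μ (fun y ↦ ‖iteratedFDeriv ℝ k f y‖) x
  · obtain ⟨C, hC, h⟩ := exists_pow_mul_norm_iteratedFDeriv_le μ hlt
    refine ⟨C, hC, fun f R hf hR hRm x t ht ↦ (h f R hf hR hRm x t ht).trans ?_⟩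
    gcongr
    · exact maximalReal_le_majorant μ (fun _ ↦ abs_nonneg _) x
    · exact maximalReal_le_majorant μ (fun _ ↦ norm_nonneg _) x

theorem exists_norm_iteratedFDeriv_mul_norm_iteratedFDeriv_le {k m : ℕ} (hkm : k ≤ m)
    (hm : 0 < m) :
    ∃ C > 0, ∀ (f g : E → ℝ) (R : ℝ), ContDiff ℝ ∞ f → ContDiff ℝ ∞ g →
      (∀ x, |f x| ≤ R) → (∀ x, ‖iteratedFDeriv ℝ m f x‖ ≤ R) →
      (∀ x, |g x| ≤ R) → (∀ x, ‖iteratedFDeriv ℝ m g x‖ ≤ R) → ∀ x : E,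
        ‖iteratedFDeriv ℝ k f x‖ * ‖iteratedFDeriv ℝ (m - k) g x‖ ≤
          C * (majorant μ (fun y ↦ |f y|) x *
              majorant μ (fun y ↦ ‖iteratedFDeriv ℝ m g y‖) x +
            majorant μ (fun y ↦ ‖iteratedFDeriv ℝ m f y‖) x *
              majorant μ (fun y ↦ |g y|) x) := by
  obtain ⟨C₁, hC₁, h₁⟩ := exists_pow_mul_norm_iteratedFDeriv_le_majorant μ hkm
  obtain ⟨C₂, hC₂, h₂⟩ := exists_pow_mul_norm_iteratedFDeriv_le_majorant μ (Nat.sub_le m k)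
  refine ⟨C₁ * C₂ * 2, by positivity, fun f g R hf hg hf0 hfm hg0 hgm x ↦ ?_⟩
  rw [mul_assoc (C₁ * C₂), ← div_le_iff₀' (by positivity)]
  refine le_two_mul_of_forall_mul_le (majorant_nonneg μ (fun _ ↦ abs_nonneg _) x)
    (majorant_nonneg μ (fun _ ↦ norm_nonneg _) x) (majorant_nonneg μ (fun _ ↦ abs_nonneg _) x)
    (majorant_nonneg μ (fun _ ↦ norm_nonneg _) x) fun τ hτ ↦ ?_
  set t : ℝ := τ ^ ((m : ℝ)⁻¹)
  have ht : 0 < t := by positivity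
  have htm : t ^ m = τ := Real.rpow_inv_natCast_pow hτ.le hm.ne'
  have hmul := mul_le_mul (h₁ f R hf hf0 hfm x t ht) (h₂ g R hg hg0 hgm x t ht) (by positivity)
    ((by positivity : (0 : ℝ) ≤ _).trans (h₁ f R hf hf0 hfm x t ht))
  rw [← mul_div_assoc, div_le_iff₀ (by positivity)]
  calc τ * (‖iteratedFDeriv ℝ k f x‖ * ‖iteratedFDeriv ℝ (m - k) g x‖)
      = t ^ k * ‖iteratedFDeriv ℝ k f x‖ *
          (t ^ (m - k) * ‖iteratedFDeriv ℝ (m - k) g x‖) := by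
        rw [← htm, ← pow_mul_pow_sub t hkm]; ring
    _ ≤ _ := hmul
    _ = _ := by rw [htm]; ring

/-- Pointwise Leibniz-type inequality with only extremal derivatives on the right. -/
theorem exists_norm_iteratedFDeriv_mul_le_majorant {m : ℕ} (hm : 0 < m) :
    ∃ C > 0, ∀ (f g : E → ℝ) (R : ℝ), ContDiff ℝ ∞ f → ContDiff ℝ ∞ g →
      (∀ x, |f x| ≤ R) → (∀ x, ‖iteratedFDeriv ℝ m f x‖ ≤ R) →
      (∀ x, |g x| ≤ R) → (∀ x, ‖iteratedFDeriv ℝ m g x‖ ≤ R) → ∀ x : E,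
        ‖iteratedFDeriv ℝ m (fun y ↦ f y * g y) x‖ ≤
          C * (majorant μ (fun y ↦ |f y|) x *
              majorant μ (fun y ↦ ‖iteratedFDeriv ℝ m g y‖) x +
            majorant μ (fun y ↦ ‖iteratedFDeriv ℝ m f y‖) x *
              majorant μ (fun y ↦ |g y|) x) := by
  have hex : ∀ k : ℕ, ∃ C > 0, k ≤ m → ∀ (f g : E → ℝ) (R : ℝ), ContDiff ℝ ∞ f → ContDiff ℝ ∞ g →
      (∀ x, |f x| ≤ R) → (∀ x, ‖iteratedFDeriv ℝ m f x‖ ≤ R) →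
      (∀ x, |g x| ≤ R) → (∀ x, ‖iteratedFDeriv ℝ m g x‖ ≤ R) → ∀ x : E,
        ‖iteratedFDeriv ℝ k f x‖ * ‖iteratedFDeriv ℝ (m - k) g x‖ ≤
          C * (majorant μ (fun y ↦ |f y|) x *
              majorant μ (fun y ↦ ‖iteratedFDeriv ℝ m g y‖) x +
            majorant μ (fun y ↦ ‖iteratedFDeriv ℝ m f y‖) x *
              majorant μ (fun y ↦ |g y|) x) := by
    intro k
    by_cases hk : k ≤ m
    · obtain ⟨C, hC, h⟩ := exists_norm_iteratedFDeriv_mul_norm_iteratedFDeriv_le μ hk hm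
      exact ⟨C, hC, fun _ ↦ h⟩
    · exact ⟨1, one_pos, fun h ↦ absurd h hk⟩
  choose C hC h using hex
  refine ⟨∑ k ∈ Finset.range (m + 1), m.choose k * C k, ?_, ?_⟩
  · refine Finset.sum_pos (fun k hk ↦ ?_) (by simp)
    have := Nat.choose_pos (Finset.mem_range_succ_iff.1 hk)
    have := hC k
    positivity
  · intro f g R hf hg hf0 hfm hg0 hgm x
    refine (norm_iteratedFDeriv_mul_le (n := m) hf hg x (mod_cast le_top)).trans ?_
    rw [Finset.sum_mul]
    refine Finset.sum_le_sum fun k hk ↦ ?_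
    rw [mul_assoc, mul_assoc]
    refine mul_le_mul_of_nonneg_left ?_ (Nat.cast_nonneg _)
    exact h k (Finset.mem_range_succ_iff.1 hk) f g R hf hg hf0 hfm hg0 hgm x

end Product

section MultiIndex

open scoped ContDiff

variable {N : ℕ} {h : EN N → ℝ}

theorem exists_pdN_eq_iteratedFDeriv (hh : ContDiff ℝ ∞ h) (i : Fin N) {n : ℕ} {u : EN N → ℝ}
    (hu : ∃ v : Fin n → EN N, (∀ j, ‖v j‖ ≤ 1) ∧ u = fun x ↦ iteratedFDeriv ℝ n h x v) :
    ∃ v : Fin (n + 1) → EN N, (∀ j, ‖v j‖ ≤ 1) ∧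
      pdN i u = fun x ↦ iteratedFDeriv ℝ (n + 1) h x v := by
  obtain ⟨v, hv, rfl⟩ := hu
  refine ⟨Fin.cons (EuclideanSpace.single i 1) v, Fin.cases (by simp) (by simpa using hv), ?_⟩
  ext x
  rw [iteratedFDeriv_succ_apply_eq_fderiv hh]
  simp [pdN]

theorem exists_pdNPow_eq_iteratedFDeriv (hh : ContDiff ℝ ∞ h) (i : Fin N) (k : ℕ) {n : ℕ}
    {u : EN N → ℝ}
    (hu : ∃ v : Fin n → EN N, (∀ j, ‖v j‖ ≤ 1) ∧ u = fun x ↦ iteratedFDeriv ℝ n h x v) :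
    ∃ v : Fin (n + k) → EN N, (∀ j, ‖v j‖ ≤ 1) ∧
      pdNPow i k u = fun x ↦ iteratedFDeriv ℝ (n + k) h x v := by
  induction k with
  | zero => exact hu
  | succ k ih => exact exists_pdN_eq_iteratedFDeriv hh i ih

theorem exists_mpd_eq_iteratedFDeriv (hh : ContDiff ℝ ∞ h) (α : Fin N → ℕ) :
    ∃ v : Fin (∑ i, α i) → EN N, (∀ j, ‖v j‖ ≤ 1) ∧
      mpd α h = fun x ↦ iteratedFDeriv ℝ (∑ i, α i) h x v := by
  rw [Fin.sum_univ_def, mpd]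
  induction List.finRange N with
  | nil =>
    exact ⟨Fin.elim0, fun j ↦ j.elim0, by ext x; exact (iteratedFDeriv_zero_apply (x := x) _).symm⟩
  | cons i l ih =>
    rw [List.map_cons, List.sum_cons, add_comm]
    exact exists_pdNPow_eq_iteratedFDeriv hh i (α i) ih

theorem abs_mpd_le_norm_iteratedFDeriv (hh : ContDiff ℝ ∞ h) (α : Fin N → ℕ) (x : EN N) :
    |mpd α h x| ≤ ‖iteratedFDeriv ℝ (∑ i, α i) h x‖ := by
  obtain ⟨v, hv, e⟩ := exists_mpd_eq_iteratedFDeriv hh α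
  rw [e, ← norm_eq_abs]
  exact ((iteratedFDeriv ℝ _ h x).le_opNorm v).trans (mul_le_of_le_one_right (norm_nonneg _)
    (Finset.prod_le_one (fun _ _ ↦ norm_nonneg _) fun j _ ↦ hv j))

end MultiIndex

theorem SchwartzMap.exists_norm_iteratedFDeriv_le {E F : Type*} [NormedAddCommGroup E]
    [NormedSpace ℝ E] [NormedAddCommGroup F] [NormedSpace ℝ F] (f : SchwartzMap E F) (n : ℕ) :
    ∃ R, ∀ x, ‖iteratedFDeriv ℝ n f x‖ ≤ R :=
  (f.decay 0 n).imp fun R hR x ↦ by simpa using hR.2 x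

/-- Hölder's inequality for products of real functions. -/
theorem eLpNorm_mul_le_of_one_div_eq {X : Type*} [MeasurableSpace X] {μ : Measure X}
    {p q r : ℝ≥0∞} (hpqr : 1 / r = 1 / p + 1 / q) {u v : X → ℝ} (hu : AEStronglyMeasurable u μ)
    (hv : AEStronglyMeasurable v μ) :
    eLpNorm (fun x ↦ u x * v x) r μ ≤ eLpNorm u p μ * eLpNorm v q μ := by
  have : ENNReal.HolderTriple p q r := ⟨by simpa using hpqr.symm⟩
  have h := eLpNorm_smul_le_mul_eLpNorm (p := p) (q := q) (r := r) hv hu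
  exact h

/-- **Calculus inequality (Leibniz/Kato–Ponce type) in the whole space.**
For exponents `1 < s, s₁, s₃ < ∞` with `1/s = 1/s₁ + 1/s₂ = 1/s₃ + 1/s₄` and a
multi-index `α` with `|α| > 0`, there is `C = C(N, α, s, s₁, s₂, s₃, s₄)` such that for
all Schwartz functions `f, g`:
`‖∂^α(fg)‖_{L^s} ≤ C (‖D^{|α|}f‖_{L^{s₁}} ‖g‖_{L^{s₂}} + ‖f‖_{L^{s₄}} ‖D^{|α|}g‖_{L^{s₃}})`. -/
theorem calculus_inequality_product
    (N : ℕ) (α : Fin N → ℕ) (hα : 0 < ∑ i, α i)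
    (s s₁ s₂ s₃ s₄ : ℝ≥0∞)
    (hs : 1 < s) (hs' : s ≠ ⊤) (hs₁ : 1 < s₁) (hs₁' : s₁ ≠ ⊤)
    (hs₃ : 1 < s₃) (hs₃' : s₃ ≠ ⊤)
    (h12 : 1 / s = 1 / s₁ + 1 / s₂) (h34 : 1 / s = 1 / s₃ + 1 / s₄) :
    ∃ C : ℝ≥0, 0 < C ∧
      ∀ f g : SchwartzMap (EN N) ℝ,
        eLpNorm (mpd α (fun x => f x * g x)) s volume ≤
          C * (eLpNorm (iteratedFDeriv ℝ (∑ i, α i) f) s₁ volume *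
                eLpNorm (⇑g) s₂ volume +
              eLpNorm (⇑f) s₄ volume *
                eLpNorm (iteratedFDeriv ℝ (∑ i, α i) g) s₃ volume) := by
  have hlt : ∀ {p q : ℝ≥0∞}, 1 / s = 1 / p + 1 / q → 1 < q := fun h ↦
    hs.trans_le (ENNReal.inv_le_inv.1 (by
      rw [← one_div, ← one_div, h]
      exact le_add_self))
  obtain ⟨K, hK, hpt⟩ := exists_norm_iteratedFDeriv_mul_le_majorant
    (volume : Measure (EN N)) hα
  obtain ⟨C₁, hC₁, h₁⟩ := eLpNorm_majorant_le (volume : Measure (EN N)) hs₁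
  obtain ⟨C₂, hC₂, h₂⟩ := eLpNorm_majorant_le (volume : Measure (EN N)) (hlt h12)
  obtain ⟨C₃, hC₃, h₃⟩ := eLpNorm_majorant_le (volume : Measure (EN N)) hs₃
  obtain ⟨C₄, hC₄, h₄⟩ := eLpNorm_majorant_le (volume : Measure (EN N)) (hlt h34)
  lift C₁ to ℝ≥0 using hC₁
  lift C₂ to ℝ≥0 using hC₂
  lift C₃ to ℝ≥0 using hC₃
  lift C₄ to ℝ≥0 using hC₄
  refine ⟨K.toNNReal * (C₄ * C₃ + C₁ * C₂ + 1), by positivity, fun f g ↦ ?_⟩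
  set m := ∑ i, α i
  have hcf := f.smooth'
  have hcg := g.smooth'
  have hbdd : ∀ u : SchwartzMap (EN N) ℝ, ∃ R, (∀ x, |u x| ≤ R) ∧
      ∀ x, ‖iteratedFDeriv ℝ m u x‖ ≤ R := by
    intro u
    obtain ⟨R₀, hR₀⟩ := u.exists_norm_iteratedFDeriv_le 0
    obtain ⟨R₁, hR₁⟩ := u.exists_norm_iteratedFDeriv_le m
    exact ⟨max R₀ R₁, fun x ↦ le_max_of_le_left (by simpa using hR₀ x),
      fun x ↦ le_max_of_le_right (hR₁ x)⟩
  obtain ⟨Rf, hf0, hfm⟩ := hbdd f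
  obtain ⟨Rg, hg0, hgm⟩ := hbdd g
  have hder : ∀ u : SchwartzMap (EN N) ℝ, Continuous fun x ↦ ‖iteratedFDeriv ℝ m u x‖ := fun u ↦
    ((u.smooth m).continuous_iteratedFDeriv le_rfl).norm
  have habs : ∀ u : SchwartzMap (EN N) ℝ, Continuous fun x ↦ |u x| := fun u ↦ u.continuous.abs
  set F₀ := majorant volume fun y ↦ |f y|
  set Fm := majorant volume fun y ↦ ‖iteratedFDeriv ℝ m f y‖
  set G₀ := majorant volume fun y ↦ |g y|
  set Gm := majorant volume fun y ↦ ‖iteratedFDeriv ℝ m g y‖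
  have mF₀ : AEStronglyMeasurable F₀ volume :=
    (measurable_majorant volume (habs f) fun _ ↦ abs_nonneg _).aestronglyMeasurable
  have mFm : AEStronglyMeasurable Fm volume :=
    (measurable_majorant volume (hder f) fun _ ↦ norm_nonneg _).aestronglyMeasurable
  have mG₀ : AEStronglyMeasurable G₀ volume :=
    (measurable_majorant volume (habs g) fun _ ↦ abs_nonneg _).aestronglyMeasurable
  have mGm : AEStronglyMeasurable Gm volume :=
    (measurable_majorant volume (hder g) fun _ ↦ norm_nonneg _).aestronglyMeasurable
  have nF₀ : eLpNorm F₀ s₄ volume ≤ C₄ * eLpNorm f s₄ volume :=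
    (h₄ _ Rf (habs f) (fun _ ↦ abs_nonneg _) hf0).trans_eq (by rw [← eLpNorm_norm f]; rfl)
  have nFm : eLpNorm Fm s₁ volume ≤ C₁ * eLpNorm (iteratedFDeriv ℝ m f) s₁ volume :=
    (h₁ _ Rf (hder f) (fun _ ↦ norm_nonneg _) hfm).trans_eq (by rw [eLpNorm_norm])
  have nG₀ : eLpNorm G₀ s₂ volume ≤ C₂ * eLpNorm g s₂ volume :=
    (h₂ _ Rg (habs g) (fun _ ↦ abs_nonneg _) hg0).trans_eq (by rw [← eLpNorm_norm g]; rfl)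
  have nGm : eLpNorm Gm s₃ volume ≤ C₃ * eLpNorm (iteratedFDeriv ℝ m g) s₃ volume :=
    (h₃ _ Rg (hder g) (fun _ ↦ norm_nonneg _) hgm).trans_eq (by rw [eLpNorm_norm])
  have hdom : ∀ x, ‖mpd α (fun x ↦ f x * g x) x‖ ≤
      K.toNNReal * ‖F₀ x * Gm x + Fm x * G₀ x‖ := by
    intro x
    rw [Real.coe_toNNReal _ hK.le]
    refine (abs_mpd_le_norm_iteratedFDeriv (hcf.mul hcg) α x).trans
      ((hpt f g (max Rf Rg) hcf hcg (fun x ↦ le_max_of_le_left (hf0 x))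
        (fun x ↦ le_max_of_le_left (hfm x)) (fun x ↦ le_max_of_le_right (hg0 x))
        (fun x ↦ le_max_of_le_right (hgm x)) x).trans ?_)
    gcongr
    exact le_abs_self _
  calc eLpNorm (mpd α fun x ↦ f x * g x) s volume
      ≤ K.toNNReal * eLpNorm (fun x ↦ F₀ x * Gm x + Fm x * G₀ x) s volume :=
        eLpNorm_le_nnreal_smul_eLpNorm_of_ae_le_mul (ae_of_all _ hdom) s
    _ ≤ K.toNNReal * (eLpNorm F₀ s₄ volume * eLpNorm Gm s₃ volume +
          eLpNorm Fm s₁ volume * eLpNorm G₀ s₂ volume) := by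
        gcongr
        refine (eLpNorm_add_le (mF₀.mul mGm) (mFm.mul mG₀) hs.le).trans ?_
        gcongr
        · exact eLpNorm_mul_le_of_one_div_eq (h34.trans (add_comm _ _)) mF₀ mGm
        · exact eLpNorm_mul_le_of_one_div_eq h12 mFm mG₀
    _ ≤ K.toNNReal * (C₄ * eLpNorm f s₄ volume * (C₃ * eLpNorm (iteratedFDeriv ℝ m g) s₃ volume) +
          C₁ * eLpNorm (iteratedFDeriv ℝ m f) s₁ volume * (C₂ * eLpNorm g s₂ volume)) := by
        gcongr
    _ = K.toNNReal * ((C₁ * C₂) * (eLpNorm (iteratedFDeriv ℝ m f) s₁ volume *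
          eLpNorm g s₂ volume) + (C₄ * C₃) * (eLpNorm f s₄ volume *
          eLpNorm (iteratedFDeriv ℝ m g) s₃ volume)) := by ring
    _ ≤ K.toNNReal * ((C₄ * C₃ + C₁ * C₂ + 1) * (eLpNorm (iteratedFDeriv ℝ m f) s₁ volume *
          eLpNorm g s₂ volume) + (C₄ * C₃ + C₁ * C₂ + 1) * (eLpNorm f s₄ volume *
          eLpNorm (iteratedFDeriv ℝ m g) s₃ volume)) := by
        gcongr
        · exact le_add_self.trans le_self_add
        · exact le_self_add.trans le_self_add
    _ = _ := by push_cast; ring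
end
end

section
/- Let s ∈ (1,∞), let α ∈ ℕ^N be a multi-index with |α| = α₁ + ⋯ + α_N > 0, and let s₁, s₂, s₃, s₄ with s₁, s₃ ∈ (1,∞) satisfy 1/s = 1/s₁ + 1/s₂ = 1/s₃ + 1/s₄. Then there exists a constant C, depending only on N, α, s, s₁, s₂, s₃, s₄, such that for all Schwartz functions f, g on ℝ^N: ‖∂^α(fg) − f ∂^α g‖_{L^s(ℝ^N)} ≤ C ( ‖D^{|α|}f‖_{L^{s₁}(ℝ^N)} ‖g‖_{L^{s₂}(ℝ^N)} + ‖∇f‖_{L^{s₄}(ℝ^N)} ‖D^{|α|−1}g‖_{L^{s₃}(ℝ^N)} ). -/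
open MeasureTheory Real
open scoped ENNReal NNReal

noncomputable section

open Set Filter Topology

/-- The one-sided Hardy–Littlewood maximal function of `G` along the direction `e`, with the
supremum restricted to rational lengths. -/
def lineMaximal {E : Type*} [AddCommGroup E] [Module ℝ E] (e : E) (G : E → ℝ≥0∞) (x : E) :
    ℝ≥0∞ :=
  ⨆ h : {q : ℚ // 0 < q}, (∫⁻ t in Icc (0 : ℝ) (h : ℚ), G (x + t • e)) / ENNReal.ofReal (h : ℚ)

theorem measurable_lineMaximal {E : Type*} [NormedAddCommGroup E] [NormedSpace ℝ E]
    [MeasurableSpace E] [BorelSpace E] [SecondCountableTopology E] (e : E) {G : E → ℝ≥0∞}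
    (hG : Measurable G) : Measurable (lineMaximal e G) := by
  refine Measurable.iSup fun h => Measurable.div_const ?_ _
  refine Measurable.lintegral_prod_right' (f := fun z : E × ℝ => G (z.1 + z.2 • e)) ?_
  exact hG.comp (by fun_prop)

theorem lintegral_le_mul_lineMaximal {E : Type*} [AddCommGroup E] [Module ℝ E] (e : E)
    (G : E → ℝ≥0∞) (x : E) {q : ℚ} (hq : 0 < q) :
    ∫⁻ t in Icc (0 : ℝ) q, G (x + t • e) ≤ lineMaximal e G x * ENNReal.ofReal q := by
  have hq' : (0 : ℝ) < q := by exact_mod_cast hq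
  rw [← ENNReal.div_le_iff (by simpa using hq') ENNReal.ofReal_ne_top]
  exact le_iSup (fun h : {q : ℚ // 0 < q} =>
    (∫⁻ t in Icc (0 : ℝ) (h : ℚ), G (x + t • e)) / ENNReal.ofReal (h : ℚ)) ⟨q, hq⟩

theorem lineMaximal_le_of_forall_le {E : Type*} [AddCommGroup E] [Module ℝ E] (e : E)
    {G : E → ℝ≥0∞} {M : ℝ≥0∞} (hG : ∀ x, G x ≤ M) (x : E) : lineMaximal e G x ≤ M := by
  refine iSup_le fun h => ENNReal.div_le_of_le_mul ?_
  calc ∫⁻ t in Icc (0 : ℝ) (h : ℚ), G (x + t • e) ≤ ∫⁻ _ in Icc (0 : ℝ) (h : ℚ), M :=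
        lintegral_mono fun t => hG _
    _ = M * ENNReal.ofReal (h : ℚ) := by simp

theorem mul_volume_lt_lineMaximal_le (g : ℝ → ℝ≥0∞) (c : ℝ≥0∞) :
    c * volume {x : ℝ | c < lineMaximal 1 g x} ≤ 10 * ∫⁻ x, g x := by
  rcases eq_or_ne c 0 with rfl | hc0
  · simp
  rcases eq_or_ne c ⊤ with rfl | hct
  · simp
  rcases eq_or_ne (∫⁻ x, g x) ⊤ with hI | hI
  · simp [hI]
  have key : ∀ x ∈ {x : ℝ | c < lineMaximal 1 g x}, ∃ h : ℝ, 0 < h ∧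
      c * ENNReal.ofReal h ≤ ∫⁻ y in Metric.closedBall x h, g y := by
    intro x hx
    rw [Set.mem_ofPred_eq, lineMaximal, lt_iSup_iff] at hx
    obtain ⟨⟨q, hq⟩, hlt⟩ := hx
    have hq' : (0 : ℝ) < q := by exact_mod_cast hq
    refine ⟨q, hq', ?_⟩
    have h1 := (ENNReal.lt_div_iff_mul_lt (Or.inl (by simpa using hq'))
      (Or.inl ENNReal.ofReal_ne_top)).1 hlt
    refine h1.le.trans ?_
    have h2 : ∫⁻ t in Icc (0 : ℝ) q, g (x + t • 1) = ∫⁻ y in Icc x (x + q), g y := by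
      have := (measurePreserving_add_left volume x).setLIntegral_comp_preimage_emb
        (measurableEmbedding_addLeft x) g (Icc x (x + q))
      simpa using this
    simp only [] at h2 ⊢
    rw [h2]
    refine lintegral_mono_set fun y hy => ?_
    rw [Real.closedBall_eq_Icc]
    exact ⟨by linarith [hy.1], hy.2⟩
  choose! r hr0 hr using key
  set E := {x : ℝ | c < lineMaximal 1 g x}
  have hcpos : 0 < c.toReal := ENNReal.toReal_pos hc0 hct
  obtain ⟨u, huE, hdisj, hcov⟩ := Vitali.exists_disjoint_subfamily_covering_enlargement_closedBall
    E id r ((∫⁻ x, g x).toReal / c.toReal) (by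
      intro a ha
      rw [le_div_iff₀ hcpos]
      have h1 := (hr a ha).trans (setLIntegral_le_lintegral _ _)
      have h2 := ENNReal.toReal_mono hI h1
      rw [ENNReal.toReal_mul, ENNReal.toReal_ofReal (hr0 a ha).le] at h2
      linarith) 5 (by norm_num)
  have hcount : u.Countable := by
    refine hdisj.countable_of_nonempty_interior fun a ha => ?_
    exact ⟨a, Metric.ball_subset_interior_closedBall (Metric.mem_ball_self (hr0 a (huE ha)))⟩
  have hsub : E ⊆ ⋃ b ∈ u, Metric.closedBall b (5 * r b) := by
    intro a ha
    obtain ⟨b, hb, hab⟩ := hcov a ha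
    exact mem_biUnion hb (hab (Metric.mem_closedBall_self (hr0 a ha).le))
  have := hcount.to_subtype
  calc c * volume E ≤ c * ∑' b : u, volume (Metric.closedBall (b : ℝ) (5 * r b)) := by
        gcongr
        exact (measure_mono hsub).trans (measure_biUnion_le _ hcount _)
    _ = ∑' b : u, 10 * (c * ENNReal.ofReal (r b)) := by
        rw [← ENNReal.tsum_mul_left]
        congr 1 with b
        rw [Real.volume_closedBall, show 2 * (5 * r b) = 10 * r b by ring,
          ENNReal.ofReal_mul (by norm_num), ENNReal.ofReal_ofNat]
        ring
    _ ≤ ∑' b : u, 10 * ∫⁻ y in Metric.closedBall (b : ℝ) (r b), g y := by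
        gcongr with b
        exact hr b (huE b.2)
    _ = 10 * ∫⁻ y in ⋃ b ∈ u, Metric.closedBall (b : ℝ) (r b), g y := by
        rw [ENNReal.tsum_mul_left]
        congr 1
        exact (lintegral_biUnion hcount
          (fun b _ => Metric.isClosed_closedBall.measurableSet) hdisj _).symm
    _ ≤ 10 * ∫⁻ x, g x := by
        gcongr
        exact Measure.restrict_le_self

/-- The maximal inequality on the line. -/
theorem lintegral_lineMaximal_rpow_le {p : ℝ} (hp : 1 < p) {g : ℝ → ℝ≥0∞} (hg : Measurable g)
    {M : ℝ≥0} (hM : ∀ x, g x ≤ M) :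
    ∫⁻ x, lineMaximal 1 g x ^ p ≤
      ENNReal.ofReal (20 * p / (p - 1) * 2 ^ (p - 1)) * ∫⁻ x, g x ^ p := by
  have hp0 : 0 < p := by linarith
  have hp1 : 0 < p - 1 := by linarith
  have hfin : ∀ x, lineMaximal 1 g x ≠ ⊤ := fun x =>
    ((lineMaximal_le_of_forall_le 1 hM x).trans_lt ENNReal.coe_lt_top).ne
  have hgfin : ∀ x, g x ≠ ⊤ := fun x => ((hM x).trans_lt ENNReal.coe_lt_top).ne
  have hlevel : ∀ c : ℝ, 0 < c → volume {x : ℝ | c < (lineMaximal 1 g x).toReal} ≤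
      ENNReal.ofReal (20 / c) * (volume.withDensity g) {x | c < 2 * (g x).toReal} := by
    intro c hc
    have hmeas : MeasurableSet {x | c < 2 * (g x).toReal} :=
      measurableSet_lt measurable_const (hg.ennreal_toReal.const_mul 2)
    set S := {x | c < 2 * (g x).toReal}
    have hsub : {x : ℝ | c < (lineMaximal 1 g x).toReal} ⊆
        {x | ENNReal.ofReal (c / 2) < lineMaximal 1 (S.indicator g) x} := by
      intro x hx
      by_contra hcon
      simp only [Set.mem_ofPred_eq, not_lt] at hcon hx
      have : lineMaximal 1 g x ≤ ENNReal.ofReal c := by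
        refine iSup_le fun h => ENNReal.div_le_of_le_mul ?_
        have hgle : ∀ y, g y ≤ S.indicator g y + ENNReal.ofReal (c / 2) := by
          intro y
          by_cases hy : y ∈ S
          · simp [hy]
          · have : 2 * (g y).toReal ≤ c := not_lt.1 hy
            simp only [hy, not_false_eq_true, indicator_of_notMem, zero_add]
            rw [ENNReal.le_ofReal_iff_toReal_le (hgfin y) (by positivity)]
            linarith
        calc ∫⁻ t in Icc (0 : ℝ) (h : ℚ), g (x + t • 1)
            ≤ ∫⁻ t in Icc (0 : ℝ) (h : ℚ), (S.indicator g (x + t • 1) + ENNReal.ofReal (c / 2)) :=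
              lintegral_mono fun t => hgle _
          _ = (∫⁻ t in Icc (0 : ℝ) (h : ℚ), S.indicator g (x + t • 1)) +
                ENNReal.ofReal (c / 2) * ENNReal.ofReal (h : ℚ) := by
              rw [lintegral_add_right _ measurable_const]
              simp
          _ ≤ lineMaximal 1 (S.indicator g) x * ENNReal.ofReal (h : ℚ) +
                ENNReal.ofReal (c / 2) * ENNReal.ofReal (h : ℚ) := by
              gcongr
              exact lintegral_le_mul_lineMaximal 1 _ x h.2
          _ ≤ ENNReal.ofReal (c / 2) * ENNReal.ofReal (h : ℚ) +
                ENNReal.ofReal (c / 2) * ENNReal.ofReal (h : ℚ) := by gcongr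
          _ = ENNReal.ofReal c * ENNReal.ofReal (h : ℚ) := by
              rw [← add_mul, ← ENNReal.ofReal_add (by positivity) (by positivity), add_halves]
      have := ENNReal.toReal_le_of_le_ofReal hc.le this
      linarith
    have hweak := mul_volume_lt_lineMaximal_le (S.indicator g) (ENNReal.ofReal (c / 2))
    rw [lintegral_indicator hmeas, ← withDensity_apply _ hmeas] at hweak
    calc volume {x : ℝ | c < (lineMaximal 1 g x).toReal}
        ≤ volume {x | ENNReal.ofReal (c / 2) < lineMaximal 1 (S.indicator g) x} :=
          measure_mono hsub
      _ = ENNReal.ofReal (2 / c) * (ENNReal.ofReal (c / 2) *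
            volume {x | ENNReal.ofReal (c / 2) < lineMaximal 1 (S.indicator g) x}) := by
          rw [← mul_assoc, ← ENNReal.ofReal_mul (by positivity)]
          field_simp
          simp
      _ ≤ ENNReal.ofReal (2 / c) * (10 * (volume.withDensity g) S) := by gcongr
      _ = ENNReal.ofReal (20 / c) * (volume.withDensity g) S := by
          rw [← mul_assoc, ← ENNReal.ofReal_ofNat 10, ← ENNReal.ofReal_mul (by positivity)]
          congr 2
          ring
  have hmM : Measurable (fun x => (lineMaximal 1 g x).toReal) :=
    (measurable_lineMaximal 1 hg).ennreal_toReal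
  have hL : ∫⁻ x, lineMaximal 1 g x ^ p =
      ∫⁻ x, ENNReal.ofReal ((lineMaximal 1 g x).toReal ^ p) := by
    congr 1 with x
    rw [← ENNReal.ofReal_rpow_of_nonneg ENNReal.toReal_nonneg hp0.le,
      ENNReal.ofReal_toReal (hfin x)]
  have hm2 : Measurable (fun x => 2 * (g x).toReal) := hg.ennreal_toReal.const_mul 2
  have hR := lintegral_rpow_eq_lintegral_meas_lt_mul (volume.withDensity g)
    (f := fun x => 2 * (g x).toReal) (Eventually.of_forall fun x => by positivity)
    hm2.aemeasurable hp1
  have hR2 : ∫⁻ x, ENNReal.ofReal ((2 * (g x).toReal) ^ (p - 1)) ∂(volume.withDensity g) =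
      ENNReal.ofReal (2 ^ (p - 1)) * ∫⁻ x, g x ^ p := by
    rw [lintegral_withDensity_eq_lintegral_mul _ hg
      (by fun_prop), ← lintegral_const_mul _ (hg.pow_const p)]
    congr 1 with x
    rw [Pi.mul_apply, Real.mul_rpow (by norm_num) ENNReal.toReal_nonneg,
      ENNReal.ofReal_mul (by positivity),
      ← ENNReal.ofReal_rpow_of_nonneg ENNReal.toReal_nonneg hp1.le,
      ENNReal.ofReal_toReal (hgfin x)]
    have : g x ^ p = g x * g x ^ (p - 1) := by
      conv_rhs => rw [← ENNReal.rpow_one (g x), ← ENNReal.rpow_mul, one_mul]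
      rw [← ENNReal.rpow_add_of_nonneg _ _ zero_le_one hp1.le]
      congr 1; ring
    rw [this]
    ring
  rw [hL, lintegral_rpow_eq_lintegral_meas_lt_mul _ (Eventually.of_forall fun x => by positivity)
    hmM.aemeasurable hp0]
  calc ENNReal.ofReal p * ∫⁻ t in Ioi (0 : ℝ), volume {a | t < (lineMaximal 1 g a).toReal} *
          ENNReal.ofReal (t ^ (p - 1))
      ≤ ENNReal.ofReal p * ∫⁻ t in Ioi (0 : ℝ), ENNReal.ofReal 20 *
          ((volume.withDensity g) {x | t < 2 * (g x).toReal} *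
            ENNReal.ofReal (t ^ (p - 1 - 1))) := by
        gcongr 1
        refine setLIntegral_mono' measurableSet_Ioi fun t ht => ?_
        have ht' : (0 : ℝ) < t := ht
        calc _ ≤ ENNReal.ofReal (20 / t) * (volume.withDensity g) {x | t < 2 * (g x).toReal} *
              ENNReal.ofReal (t ^ (p - 1)) := by gcongr; exact hlevel t ht'
          _ = _ := by
            rw [Real.rpow_sub_one ht'.ne' (p - 1), mul_right_comm,
              ← ENNReal.ofReal_mul (by positivity), mul_left_comm,
              ← ENNReal.ofReal_mul (by positivity), mul_comm]
            congr 2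
            ring
    _ = ENNReal.ofReal p * (ENNReal.ofReal 20 * (∫⁻ t in Ioi (0 : ℝ),
          ((volume.withDensity g) {x | t < 2 * (g x).toReal} *
            ENNReal.ofReal (t ^ (p - 1 - 1))))) := by
        rw [lintegral_const_mul' _ _ ENNReal.ofReal_ne_top]
    _ = ENNReal.ofReal (20 * p / (p - 1)) * (ENNReal.ofReal (p - 1) * (∫⁻ t in Ioi (0 : ℝ),
          ((volume.withDensity g) {x | t < 2 * (g x).toReal} *
            ENNReal.ofReal (t ^ (p - 1 - 1))))) := by
        rw [← mul_assoc, ← mul_assoc, ← ENNReal.ofReal_mul (by positivity),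
          ← ENNReal.ofReal_mul (by positivity)]
        congr 2
        field_simp
    _ = _ := by
        rw [← hR, hR2, ← mul_assoc, ← ENNReal.ofReal_mul (by positivity)]

open LineDeriv SchwartzMap

theorem lintegral_euclideanSpace_eq_lintegral_insertNth {n : ℕ} (i : Fin (n + 1))
    {F : EN (n + 1) → ℝ≥0∞} (hF : Measurable F) :
    ∫⁻ x, F x = ∫⁻ y : Fin n → ℝ, ∫⁻ t : ℝ, F (WithLp.toLp 2 (i.insertNth t y)) := by
  have hF' : Measurable fun x : Fin (n + 1) → ℝ => F (WithLp.toLp 2 x) :=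
    hF.comp (PiLp.continuous_toLp 2 _).measurable
  refine ((PiLp.volume_preserving_toLp (Fin (n + 1))).lintegral_comp hF).symm.trans ?_
  refine (((volume_preserving_piFinSuccAbove (fun _ : Fin (n + 1) => ℝ) i).symm
    _).lintegral_comp hF').symm.trans ?_
  exact lintegral_prod_symm _ (hF'.comp (MeasurableEquiv.measurable _)).aemeasurable

theorem lineMaximal_single_insertNth {n : ℕ} (i : Fin (n + 1)) (G : EN (n + 1) → ℝ≥0∞)
    (y : Fin n → ℝ) (t : ℝ) :
    lineMaximal (EuclideanSpace.single i (1 : ℝ)) G (WithLp.toLp 2 (i.insertNth t y)) =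
      lineMaximal 1 (fun r => G (WithLp.toLp 2 (i.insertNth r y))) t := by
  have : ∀ r : ℝ, (WithLp.toLp 2 (i.insertNth (α := fun _ => ℝ) t y) : EN (n + 1)) +
      r • EuclideanSpace.single i (1 : ℝ) =
        WithLp.toLp 2 (i.insertNth (α := fun _ => ℝ) (t + r • 1) y) := by
    intro r
    ext j
    refine Fin.succAboveCases i ?_ (fun k => ?_) j
    · simp
    · simp
  simp only [lineMaximal, this]

theorem lintegral_lineMaximal_single_rpow_le {N : ℕ} (i : Fin N) {p : ℝ} (hp : 1 < p)
    {G : EN N → ℝ≥0∞} (hG : Measurable G) {M : ℝ≥0} (hM : ∀ x, G x ≤ M) :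
    ∫⁻ x, lineMaximal (EuclideanSpace.single i (1 : ℝ)) G x ^ p ≤
      ENNReal.ofReal (20 * p / (p - 1) * 2 ^ (p - 1)) * ∫⁻ x, G x ^ p := by
  obtain _ | n := N
  · exact i.elim0
  rw [lintegral_euclideanSpace_eq_lintegral_insertNth i
      ((measurable_lineMaximal _ hG).pow_const p),
    lintegral_euclideanSpace_eq_lintegral_insertNth i (hG.pow_const p),
    ← lintegral_const_mul' _ _ ENNReal.ofReal_ne_top]
  refine lintegral_mono fun y => ?_
  simp only [lineMaximal_single_insertNth]
  refine lintegral_lineMaximal_rpow_le hp (hG.comp ?_) (fun x => hM _)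
  have : Continuous fun t : ℝ => i.insertNth (α := fun _ => ℝ) t y := by fun_prop
  exact ((PiLp.continuous_toLp 2 _).comp this).measurable

theorem enorm_le_eLpNorm_top {X : Type*} [TopologicalSpace X] [MeasurableSpace X]
    {μ : Measure X} [μ.IsOpenPosMeasure] {v : X → ℝ} (hv : Continuous v) (x : X) :
    ‖v x‖ₑ ≤ eLpNorm v ⊤ μ := by
  by_contra! hlt
  have ho : IsOpen {y | eLpNorm v ⊤ μ < ‖v y‖ₑ} := isOpen_lt continuous_const hv.enorm
  refine (ho.measure_pos μ ⟨x, hlt⟩).ne' ?_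
  have h := ae_le_eLpNormEssSup (f := v) (μ := μ)
  rw [ae_iff] at h
  simpa only [eLpNorm_exponent_top, not_le] using h

theorem exists_eLpNorm_lineMaximal_le {p : ℝ≥0∞} (hp : 1 < p) :
    ∃ C : ℝ≥0, ∀ (N : ℕ) (i : Fin N) (v : EN N → ℝ), Continuous v →
      (∃ M : ℝ≥0, ∀ x, ‖v x‖ₑ ≤ M) →
      eLpNorm (fun x => (lineMaximal (EuclideanSpace.single i (1 : ℝ)) (‖v ·‖ₑ) x).toReal) p volume
        ≤ C * eLpNorm v p volume := by
  have hfin : ∀ (N : ℕ) (i : Fin N) (v : EN N → ℝ), (∃ M : ℝ≥0, ∀ x, ‖v x‖ₑ ≤ M) → ∀ x,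
      ‖(lineMaximal (EuclideanSpace.single i (1 : ℝ)) (‖v ·‖ₑ) x).toReal‖ₑ =
        lineMaximal (EuclideanSpace.single i (1 : ℝ)) (‖v ·‖ₑ) x := by
    rintro N i v ⟨M, hM⟩ x
    rw [Real.enorm_eq_ofReal ENNReal.toReal_nonneg, ENNReal.ofReal_toReal]
    exact ((lineMaximal_le_of_forall_le _ hM x).trans_lt ENNReal.coe_lt_top).ne
  rcases eq_or_ne p ⊤ with rfl | hpt
  · refine ⟨1, fun N i v hv hM => ?_⟩
    rw [ENNReal.coe_one, one_mul, eLpNorm_exponent_top]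
    refine essSup_le_of_ae_le _ (Eventually.of_forall fun x => ?_)
    simp only [hfin N i v hM]
    exact lineMaximal_le_of_forall_le _ (enorm_le_eLpNorm_top hv) x
  · have hp1 : 1 < p.toReal := by
      simpa using (ENNReal.toReal_lt_toReal ENNReal.one_ne_top hpt).2 hp
    have hp0 : p ≠ 0 := (zero_lt_one.trans hp).ne'
    refine ⟨(ENNReal.ofReal (20 * p.toReal / (p.toReal - 1) * 2 ^ (p.toReal - 1)) ^
      (1 / p.toReal)).toNNReal, fun N i v hv hM => ?_⟩
    rw [ENNReal.coe_toNNReal (by finiteness), eLpNorm_eq_lintegral_rpow_enorm_toReal hp0 hpt,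
      eLpNorm_eq_lintegral_rpow_enorm_toReal hp0 hpt,
      ← ENNReal.mul_rpow_of_nonneg _ _ (by positivity)]
    simp only [hfin N i v hM]
    obtain ⟨M, hM⟩ := hM
    gcongr
    exact lintegral_lineMaximal_single_rpow_le i hp1 hv.enorm.measurable hM

theorem sq_le_of_forall_mul_le_add {w a b : ℝ} (hw : 0 ≤ w) (ha : 0 ≤ a) (hb : 0 ≤ b)
    (h : ∀ q : ℚ, 0 < q → w * q ≤ a + b * q ^ 2) : w ^ 2 ≤ 4 * a * b := by
  have hall : ∀ x : ℝ, 0 ≤ b * (x * x) + (-w) * x + a := by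
    intro x
    have hc : Continuous fun x : ℝ => b * (x * x) + (-w) * x + a := by fun_prop
    refine isClosed_property (Rat.denseRange_cast (𝕜 := ℝ)) (isClosed_Ici.preimage hc)
      (fun q => ?_) x
    change 0 ≤ b * ((q : ℝ) * q) + (-w) * q + a
    rcases lt_or_ge 0 q with hq | hq
    · linarith [h q hq]
    · have hq' : (q : ℝ) ≤ 0 := by exact_mod_cast hq
      nlinarith [mul_nonneg hw (neg_nonneg.2 hq'), mul_nonneg hb (mul_self_nonneg (q : ℝ))]
  have := discrim_le_zero hall
  rw [discrim] at this
  linarith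

/-- A pointwise interpolation inequality for the derivative at the left end point, in terms of
bounds for the averages of the function and of its second derivative. -/
theorem sq_deriv_le_of_lintegral_le {φ φ₁ φ₂ : ℝ → ℝ} (h₁ : ∀ t, HasDerivAt φ (φ₁ t) t)
    (h₂ : ∀ t, HasDerivAt φ₁ (φ₂ t) t) (hφ₂ : Continuous φ₂) {A B : ℝ} (hA0 : 0 ≤ A) (hB0 : 0 ≤ B)
    (hA : ∀ q : ℚ, 0 < q →
      ∫⁻ t in Icc (0 : ℝ) q, ‖φ t‖ₑ ≤ ENNReal.ofReal A * ENNReal.ofReal q)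
    (hB : ∀ q : ℚ, 0 < q →
      ∫⁻ t in Icc (0 : ℝ) q, ‖φ₂ t‖ₑ ≤ ENNReal.ofReal B * ENNReal.ofReal q) :
    φ₁ 0 ^ 2 ≤ 72 * (A * B) := by
  have hφ : Continuous φ := continuous_iff_continuousAt.2 fun t => (h₁ t).continuousAt
  have hsmall : ∀ q : ℚ, 0 < q → ∀ a : ℝ, 0 ≤ a → a + q / 3 ≤ q →
      ∃ t ∈ Icc a (a + q / 3), |φ t| ≤ 3 * A := by
    intro q hq a ha haq
    have hq' : (0 : ℝ) < q := by exact_mod_cast hq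
    obtain ⟨t, ht, hmin⟩ := (isCompact_Icc (a := a) (b := a + q / 3)).exists_isMinOn
      ⟨a, by constructor <;> linarith⟩ hφ.abs.continuousOn
    refine ⟨t, ht, ?_⟩
    have h3 : ENNReal.ofReal (|φ t| * (q / 3)) ≤ ENNReal.ofReal (A * q) := by
      rw [ENNReal.ofReal_mul (abs_nonneg _), ENNReal.ofReal_mul hA0]
      calc _ = ∫⁻ _ in Icc a (a + q / 3), ENNReal.ofReal |φ t| := by simp
        _ ≤ ∫⁻ r in Icc a (a + q / 3), ‖φ r‖ₑ := by
          refine setLIntegral_mono' measurableSet_Icc fun r hr => ?_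
          rw [← ofReal_norm, Real.norm_eq_abs]
          exact ENNReal.ofReal_le_ofReal (hmin hr)
        _ ≤ ∫⁻ r in Icc (0 : ℝ) q, ‖φ r‖ₑ :=
          lintegral_mono_set (Icc_subset_Icc ha haq)
        _ ≤ _ := hA q hq
    have h4 := (ENNReal.ofReal_le_ofReal_iff (by positivity)).1 h3
    by_contra! hcon
    nlinarith
  have hmain : ∀ q : ℚ, 0 < q → |φ₁ 0| * q ≤ 18 * A + B * q ^ 2 := by
    intro q hq
    have hq' : (0 : ℝ) < q := by exact_mod_cast hq
    obtain ⟨t, ht, hφt⟩ := hsmall q hq 0 le_rfl (by linarith)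
    obtain ⟨r, hr, hφr⟩ := hsmall q hq (2 * q / 3) (by positivity) (by linarith)
    have htr : t < r := by linarith [ht.2, hr.1]
    obtain ⟨ξ, hξ, hslope⟩ := exists_hasDerivAt_eq_slope φ φ₁ htr hφ.continuousOn
      fun x _ => h₁ x
    have hξ0 : 0 ≤ ξ := by linarith [ht.1, hξ.1]
    have hξq : ξ ≤ q := by linarith [hξ.2, hr.2]
    have h5 : |φ₁ ξ - φ₁ 0| ≤ B * q := by
      rw [← intervalIntegral.integral_eq_sub_of_hasDerivAt (fun x _ => h₂ x)
        (hφ₂.intervalIntegrable _ _), intervalIntegral.integral_of_le hξ0]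
      refine (ENNReal.ofReal_le_ofReal_iff (by positivity)).1 ?_
      rw [← Real.norm_eq_abs, ofReal_norm, ENNReal.ofReal_mul hB0]
      exact (enorm_integral_le_lintegral_enorm _).trans ((lintegral_mono_set
        (Ioc_subset_Icc_self.trans (Icc_subset_Icc le_rfl hξq))).trans (hB q hq))
    have h6 : |φ₁ ξ| * (r - t) ≤ 6 * A := by
      rw [hslope, abs_div, abs_of_pos (sub_pos.2 htr),
        div_mul_cancel₀ _ (sub_pos.2 htr).ne']
      linarith [abs_sub (φ r) (φ t)]
    have h7 : |φ₁ ξ| * (q / 3) ≤ 6 * A :=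
      (mul_le_mul_of_nonneg_left (by linarith [ht.2, hr.1]) (abs_nonneg _)).trans h6
    have h8 : |φ₁ 0| ≤ |φ₁ ξ| + B * q := by
      have := abs_sub_abs_le_abs_sub (φ₁ 0) (φ₁ ξ)
      rw [abs_sub_comm] at this
      linarith
    nlinarith
  have := sq_le_of_forall_mul_le_add (abs_nonneg _) (by positivity) hB0 hmain
  rw [sq_abs] at this
  linarith

theorem hasDerivAt_schwartzMap_line {N : ℕ} (v : 𝓢(EN N, ℝ)) (x e : EN N) (t : ℝ) :
    HasDerivAt (fun t : ℝ => v (x + t • e)) ((∂_{e} v : 𝓢(EN N, ℝ)) (x + t • e)) t := by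
  have h1 : HasDerivAt (fun t : ℝ => x + t • e) e t := by
    simpa using ((hasDerivAt_id t).smul_const e).const_add x
  exact (v.differentiableAt.hasFDerivAt.comp_hasDerivAt t h1)

theorem exists_enorm_schwartzMap_le {N : ℕ} (v : 𝓢(EN N, ℝ)) : ∃ M : ℝ≥0, ∀ x, ‖v x‖ₑ ≤ M :=
  ⟨(eLpNorm v ⊤ volume).toNNReal, fun x => by
    rw [ENNReal.coe_toNNReal (v.memLp_top volume).2.ne]
    exact enorm_le_eLpNorm_top v.continuous x⟩

/-- Interpolation of a first derivative between a function and its second derivative, in terms of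
the reciprocals of the Lebesgue exponents. -/
theorem exists_eLpNorm_lineDeriv_sq_le {a b : ℝ} (ha0 : 0 ≤ a) (ha : a < 1) (hb0 : 0 ≤ b)
    (hb : b < 1) :
    ∃ C : ℝ≥0, ∀ (N : ℕ) (i : Fin N) (v : 𝓢(EN N, ℝ)),
      eLpNorm (∂_{EuclideanSpace.single i (1 : ℝ)} v : 𝓢(EN N, ℝ))
          (ENNReal.ofReal ((a + b) / 2))⁻¹ volume ^ 2 ≤
        C * (eLpNorm v (ENNReal.ofReal a)⁻¹ volume *
          eLpNorm (∂_{EuclideanSpace.single i (1 : ℝ)} (∂_{EuclideanSpace.single i (1 : ℝ)} v) :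
            𝓢(EN N, ℝ)) (ENNReal.ofReal b)⁻¹ volume) := by
  have hone : ∀ {c : ℝ}, c < 1 → 1 < (ENNReal.ofReal c)⁻¹ := fun hc =>
    ENNReal.one_lt_inv.2 (by simpa using hc)
  obtain ⟨C₁, hC₁⟩ := exists_eLpNorm_lineMaximal_le (hone ha)
  obtain ⟨C₂, hC₂⟩ := exists_eLpNorm_lineMaximal_le (hone hb)
  refine ⟨72 * (C₁ * C₂), fun N i v => ?_⟩
  set e := EuclideanSpace.single i (1 : ℝ)
  set v₁ : 𝓢(EN N, ℝ) := ∂_{e} v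
  set v₂ : 𝓢(EN N, ℝ) := ∂_{e} v₁
  set A : EN N → ℝ := fun x => (lineMaximal e (‖v ·‖ₑ) x).toReal with hA
  set B : EN N → ℝ := fun x => (lineMaximal e (‖v₂ ·‖ₑ) x).toReal with hB
  have hAm : AEStronglyMeasurable A volume :=
    (measurable_lineMaximal e v.continuous.enorm.measurable).ennreal_toReal.aestronglyMeasurable
  have hBm : AEStronglyMeasurable B volume :=
    (measurable_lineMaximal e v₂.continuous.enorm.measurable).ennreal_toReal.aestronglyMeasurable
  have hofReal : ∀ (u : 𝓢(EN N, ℝ)) (x : EN N), ENNReal.ofReal (lineMaximal e (‖u ·‖ₑ) x).toReal =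
      lineMaximal e (‖u ·‖ₑ) x := fun u x => by
    obtain ⟨M, hM⟩ := exists_enorm_schwartzMap_le u
    exact ENNReal.ofReal_toReal
      ((lineMaximal_le_of_forall_le _ hM x).trans_lt ENNReal.coe_lt_top).ne
  have hpt : ∀ x, v₁ x ^ 2 ≤ 72 * (A x * B x) := by
    intro x
    have := sq_deriv_le_of_lintegral_le (φ := fun t => v (x + t • e))
      (φ₁ := fun t => v₁ (x + t • e)) (φ₂ := fun t => v₂ (x + t • e)) (A := A x) (B := B x)
      (hasDerivAt_schwartzMap_line v x e) (hasDerivAt_schwartzMap_line v₁ x e)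
      (v₂.continuous.comp (by fun_prop)) ENNReal.toReal_nonneg ENNReal.toReal_nonneg
      (fun q hq => by
        rw [hA, hofReal]
        exact lintegral_le_mul_lineMaximal e (‖v ·‖ₑ) x hq)
      (fun q hq => by
        rw [hB, hofReal]
        exact lintegral_le_mul_lineMaximal e (‖v₂ ·‖ₑ) x hq)
    simpa using this
  have hH : ENNReal.HolderTriple (ENNReal.ofReal a)⁻¹ (ENNReal.ofReal b)⁻¹
      (ENNReal.ofReal (a + b))⁻¹ :=
    ⟨by rw [inv_inv, inv_inv, inv_inv, ENNReal.ofReal_add ha0 hb0]⟩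
  have hsq : eLpNorm v₁ (ENNReal.ofReal ((a + b) / 2))⁻¹ volume ^ 2 =
      eLpNorm (fun x => v₁ x ^ 2) (ENNReal.ofReal (a + b))⁻¹ volume := by
    have h := eLpNorm_norm_rpow (p := (ENNReal.ofReal (a + b))⁻¹) (μ := volume) v₁
      (q := 2) (by norm_num)
    have h2 : (ENNReal.ofReal (a + b))⁻¹ * ENNReal.ofReal 2 =
        (ENNReal.ofReal ((a + b) / 2))⁻¹ := by
      rw [ENNReal.ofReal_div_of_pos (by norm_num), ENNReal.inv_div (by simp) (by simp),
        div_eq_mul_inv, mul_comm]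
    rw [h2] at h
    simpa using h.symm
  rw [hsq]
  calc eLpNorm (fun x => v₁ x ^ 2) (ENNReal.ofReal (a + b))⁻¹ volume
      ≤ eLpNorm (fun x => 72 * (A x * B x)) (ENNReal.ofReal (a + b))⁻¹ volume :=
        eLpNorm_mono_real fun x => by simpa using hpt x
    _ ≤ (72 : ℝ≥0) * eLpNorm A (ENNReal.ofReal a)⁻¹ volume *
          eLpNorm B (ENNReal.ofReal b)⁻¹ volume :=
        eLpNorm_le_eLpNorm_mul_eLpNorm_of_nnnorm hAm hBm (fun y z => 72 * (y * z)) 72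
          (Eventually.of_forall fun x => by simp [mul_assoc])
    _ ≤ (72 : ℝ≥0) * (C₁ * eLpNorm v (ENNReal.ofReal a)⁻¹ volume) *
          (C₂ * eLpNorm v₂ (ENNReal.ofReal b)⁻¹ volume) := by
        gcongr
        · exact hC₁ N i v v.continuous (exists_enorm_schwartzMap_le v)
        · exact hC₂ N i v₂ v₂.continuous (exists_enorm_schwartzMap_le v₂)
    _ = _ := by push_cast; ring

/-- The iterated coordinate derivative of a Schwartz function along a list of directions. -/
def listDeriv {N : ℕ} (l : List (Fin N)) (f : 𝓢(EN N, ℝ)) : 𝓢(EN N, ℝ) :=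
  l.foldr (fun i g => ∂_{EuclideanSpace.single i (1 : ℝ)} g) f

/-- The largest `L^p` norm of an iterated coordinate derivative of order `n`. -/
def derivNorm {N : ℕ} (n : ℕ) (p : ℝ≥0∞) (f : 𝓢(EN N, ℝ)) : ℝ≥0∞ :=
  ⨆ l : {l : List (Fin N) // l.length = n}, eLpNorm (listDeriv l.1 f) p volume

theorem pdN_schwartzMap {N : ℕ} (i : Fin N) (f : 𝓢(EN N, ℝ)) :
    pdN i f = (∂_{EuclideanSpace.single i (1 : ℝ)} f : 𝓢(EN N, ℝ)) := rfl

theorem foldr_pdN_schwartzMap {N : ℕ} (l : List (Fin N)) (f : 𝓢(EN N, ℝ)) :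
    l.foldr pdN (f : EN N → ℝ) = listDeriv l f := by
  induction l with
  | nil => rfl
  | cons i l ih => rw [List.foldr_cons, ih, pdN_schwartzMap]; rfl

theorem pdNPow_eq_foldr {N : ℕ} (i : Fin N) (n : ℕ) (F : EN N → ℝ) :
    pdNPow i n F = (List.replicate n i).foldr pdN F := by
  induction n with
  | zero => rfl
  | succ n ih => rw [pdNPow, ih, List.replicate_succ, List.foldr_cons]

theorem exists_list_mpd_eq_foldr {N : ℕ} (α : Fin N → ℕ) :
    ∃ l : List (Fin N), l.length = ∑ i, α i ∧ ∀ F : EN N → ℝ, mpd α F = l.foldr pdN F := by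
  refine ⟨(List.finRange N).flatMap fun i => List.replicate (α i) i, ?_, fun F => ?_⟩
  · simp [List.length_flatMap, Fin.sum_univ_def]
  · rw [mpd]
    induction List.finRange N with
    | nil => rfl
    | cons i L ih => rw [List.foldr_cons, List.flatMap_cons, List.foldr_append, ih, pdNPow_eq_foldr]

theorem derivNorm_lt_top {N : ℕ} (n : ℕ) (p : ℝ≥0∞) (f : 𝓢(EN N, ℝ)) : derivNorm n p f < ⊤ := by
  have : Finite {l : List (Fin N) // l.length = n} := (List.finite_length_eq (Fin N) n).to_subtype
  cases isEmpty_or_nonempty {l : List (Fin N) // l.length = n}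
  · simp [derivNorm]
  · obtain ⟨l, hl⟩ := exists_eq_ciSup_of_finite
      (f := fun l : {l : List (Fin N) // l.length = n} => eLpNorm (listDeriv l.1 f) p volume)
    rw [derivNorm, ← hl]
    exact ((listDeriv l.1 f).memLp p volume).2

theorem eLpNorm_listDeriv_le {N : ℕ} (l : List (Fin N)) (p : ℝ≥0∞) (f : 𝓢(EN N, ℝ)) :
    eLpNorm (listDeriv l f) p volume ≤ derivNorm l.length p f :=
  le_iSup (fun l' : {l' : List (Fin N) // l'.length = l.length} =>
    eLpNorm (listDeriv l'.1 f) p volume) ⟨l, rfl⟩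

theorem derivNorm_zero {N : ℕ} (p : ℝ≥0∞) (f : 𝓢(EN N, ℝ)) :
    derivNorm 0 p f = eLpNorm f p volume := by
  refine le_antisymm (iSup_le ?_) (eLpNorm_listDeriv_le [] p f)
  rintro ⟨l, hl⟩
  obtain rfl := List.length_eq_zero_iff.1 hl
  exact le_rfl

theorem listDeriv_apply {N : ℕ} (l : List (Fin N)) (f : 𝓢(EN N, ℝ)) (x : EN N) :
    listDeriv l f x = iteratedFDeriv ℝ l.length f x
      fun k => EuclideanSpace.single (l.get k) (1 : ℝ) := by
  rw [← SchwartzMap.iteratedLineDerivOp_eq_iteratedFDeriv]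
  congr 1
  induction l with
  | nil => rfl
  | cons i l ih =>
    change ∂_{EuclideanSpace.single i (1 : ℝ)} (listDeriv l f) = _
    rw [ih]
    rfl

theorem derivNorm_le_eLpNorm_iteratedFDeriv {N : ℕ} (n : ℕ) (p : ℝ≥0∞) (f : 𝓢(EN N, ℝ)) :
    derivNorm n p f ≤ eLpNorm (iteratedFDeriv ℝ n f) p volume := by
  refine iSup_le ?_
  rintro ⟨l, rfl⟩
  refine eLpNorm_mono fun x => ?_
  rw [listDeriv_apply]
  refine (ContinuousMultilinearMap.le_opNorm _ _).trans ?_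
  simp

theorem derivNorm_one_le_eLpNorm_fderiv {N : ℕ} (p : ℝ≥0∞) (f : 𝓢(EN N, ℝ)) :
    derivNorm 1 p f ≤ eLpNorm (fderiv ℝ (f : EN N → ℝ)) p volume := by
  refine (derivNorm_le_eLpNorm_iteratedFDeriv 1 p f).trans_eq
    (eLpNorm_congr_norm_ae (Eventually.of_forall fun x => ?_))
  rw [← norm_iteratedFDeriv_fderiv, norm_iteratedFDeriv_zero]

theorem exists_derivNorm_sq_le {a b c : ℝ} (ha0 : 0 ≤ a) (ha : a < 1) (hb0 : 0 ≤ b)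
    (hb : b < 1) (hc : (a + b) / 2 = c) :
    ∃ C : ℝ≥0, ∀ (N : ℕ) (n : ℕ) (f : 𝓢(EN N, ℝ)),
      derivNorm (n + 1) (ENNReal.ofReal c)⁻¹ f ^ 2 ≤
        C * (derivNorm n (ENNReal.ofReal a)⁻¹ f * derivNorm (n + 2) (ENNReal.ofReal b)⁻¹ f) := by
  subst hc
  obtain ⟨C, hC⟩ := exists_eLpNorm_lineDeriv_sq_le ha0 ha hb0 hb
  refine ⟨C, fun N n f => ?_⟩
  rw [derivNorm, ENNReal.iSup_pow_of_ne_zero two_ne_zero]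
  refine iSup_le ?_
  rintro ⟨_ | ⟨i, l⟩, hl⟩
  · simp at hl
  obtain rfl : l.length = n := by simpa using hl
  refine (hC N i (listDeriv l f)).trans ?_
  gcongr
  · exact eLpNorm_listDeriv_le l _ f
  · exact eLpNorm_listDeriv_le (i :: i :: l) _ f

theorem pdN_list_sum {N : ℕ} (i : Fin N) (f g : 𝓢(EN N, ℝ))
    (L : List (List (Fin N) × List (Fin N))) :
    Differentiable ℝ (fun x => (L.map fun p => listDeriv p.1 f x * listDeriv p.2 g x).sum) ∧
    ∀ x, pdN i (fun x => (L.map fun p => listDeriv p.1 f x * listDeriv p.2 g x).sum) x =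
      (L.map fun p => listDeriv (i :: p.1) f x * listDeriv p.2 g x).sum +
      (L.map fun p => listDeriv p.1 f x * listDeriv (i :: p.2) g x).sum := by
  induction L with
  | nil => simp [pdN]
  | cons p L ih =>
    have hp : Differentiable ℝ fun x => listDeriv p.1 f x * listDeriv p.2 g x :=
      (listDeriv p.1 f).differentiable.mul (listDeriv p.2 g).differentiable
    simp only [List.map_cons, List.sum_cons]
    refine ⟨hp.add ih.1, fun x => ?_⟩
    have h1 : pdN i (fun x => listDeriv p.1 f x * listDeriv p.2 g x) x =
        listDeriv (i :: p.1) f x * listDeriv p.2 g x +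
          listDeriv p.1 f x * listDeriv (i :: p.2) g x := by
      rw [pdN, fderiv_fun_mul (listDeriv p.1 f).differentiableAt
        (listDeriv p.2 g).differentiableAt]
      simp only [add_apply, smul_apply, smul_eq_mul]
      change _ * listDeriv (i :: p.2) g x + _ * listDeriv (i :: p.1) f x = _
      ring
    have h2 := ih.2 x
    rw [pdN] at h1 h2 ⊢
    rw [fderiv_fun_add (hp x) (ih.1 x), add_apply, h1, h2]
    ring

/-- The Leibniz rule for an iterated derivative of a product, with the term where every derivative
falls on the second factor singled out. -/
theorem exists_foldr_pdN_mul_eq {N : ℕ} (l : List (Fin N)) :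
    ∃ L : List (List (Fin N) × List (Fin N)),
      (∀ p ∈ L, 0 < p.1.length ∧ p.1.length + p.2.length = l.length) ∧
      ∀ (f g : 𝓢(EN N, ℝ)) (x : EN N), l.foldr pdN (fun z => f z * g z) x =
        f x * listDeriv l g x + (L.map fun p => listDeriv p.1 f x * listDeriv p.2 g x).sum := by
  induction l with
  | nil => exact ⟨[], by simp, fun f g x => by simp [listDeriv]⟩
  | cons i l ih =>
    obtain ⟨L, hL, h⟩ := ih
    refine ⟨([i], l) :: (L.map (fun p => (i :: p.1, p.2)) ++ L.map fun p => (p.1, i :: p.2)),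
      ?_, fun f g x => ?_⟩
    · intro p hp
      simp only [List.mem_cons, List.mem_append, List.mem_map] at hp
      rcases hp with rfl | ⟨q, hq, rfl⟩ | ⟨q, hq, rfl⟩
      · simp [add_comm]
      · have := hL q hq; simp; omega
      · have := hL q hq; simp; omega
    · have hfun : l.foldr pdN (fun z => f z * g z) = fun x =>
          ((([], l) :: L).map fun p => listDeriv p.1 f x * listDeriv p.2 g x).sum :=
        funext fun x => by rw [h f g x]; rfl
      rw [List.foldr_cons, hfun, (pdN_list_sum i f g _).2]
      simp only [List.map_cons, List.sum_cons, List.map_append, List.sum_append, List.map_map,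
        Function.comp_def]
      change _ + (f x * _ + _) = _
      ring

theorem le_max_endpoints_of_sq_le_mul {S : ℕ → ℝ} (hS : ∀ j, 0 ≤ S j) {m : ℕ}
    (h : ∀ j, j + 2 ≤ m → S (j + 1) ^ 2 ≤ S j * S (j + 2)) {j : ℕ} (hj : j ≤ m) :
    S j ≤ max (S 0) (S m) := by
  obtain ⟨n, hn, hmax⟩ := (Finset.range (m + 1)).exists_max_image S ⟨0, by simp⟩
  have hex : ∃ k, k ≤ m ∧ S k = S n := ⟨n, by simpa [Nat.lt_succ_iff] using hn, rfl⟩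
  classical
  obtain ⟨hkm, hk⟩ := Nat.find_spec hex
  have hmin := fun k => Nat.find_min hex (m := k)
  set k := Nat.find hex
  have hle : ∀ r, r ≤ m → S r ≤ S k := fun r hr => hk ▸ hmax r (by simpa [Nat.lt_succ_iff] using hr)
  refine (hle j hj).trans ?_
  rcases Nat.eq_zero_or_pos k with h0 | hpos
  · rw [h0]; exact le_max_left _ _
  rcases hkm.eq_or_lt with h1 | hlt
  · rw [h1]; exact le_max_right _ _
  obtain ⟨r, hr⟩ : ∃ r, k = r + 1 := ⟨k - 1, by omega⟩
  have hlt' : S r < S k := lt_of_le_of_ne (hle r (by omega)) fun he =>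
    hmin r (by omega) ⟨by omega, he.trans hk⟩
  have hsq := h r (by omega)
  rw [← hr] at hsq
  nlinarith [hle (r + 2) (by omega), hS r, hS k, hS (r + 2)]

theorem le_mul_max_endpoints_of_sq_le_mul {T : ℕ → ℝ≥0∞} (hT : ∀ j, T j < ⊤) {m : ℕ} {K : ℝ≥0} (hK : 1 ≤ K)
    (h : ∀ j, j + 2 ≤ m → T (j + 1) ^ 2 ≤ K * (T j * T (j + 2))) {j : ℕ} (hj : j ≤ m) :
    T j ≤ K ^ m ^ 2 * max (T 0) (T m) := by
  lift T to ℕ → ℝ≥0 using fun j => (hT j).ne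
  beta_reduce at h ⊢
  norm_cast at h ⊢
  have hS := le_max_endpoints_of_sq_le_mul (S := fun j => ((K ^ j ^ 2 * T j : ℝ≥0) : ℝ))
    (fun j => NNReal.coe_nonneg _) (m := m) (fun j hj => by
      norm_cast
      calc (K ^ (j + 1) ^ 2 * T (j + 1)) ^ 2 = K ^ (2 * (j + 1) ^ 2) * T (j + 1) ^ 2 := by ring
        _ ≤ K ^ (2 * (j + 1) ^ 2) * (K * (T j * T (j + 2))) := by gcongr; exact h j hj
        _ = K ^ (2 * (j + 1) ^ 2 + 1) * (T j * T (j + 2)) := by ring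
        _ ≤ K ^ (j ^ 2 + (j + 2) ^ 2) * (T j * T (j + 2)) := by
          gcongr ?_ * _
          exact pow_le_pow_right₀ hK (by nlinarith)
        _ = K ^ j ^ 2 * T j * (K ^ (j + 2) ^ 2 * T (j + 2)) := by ring) hj
  norm_cast at hS
  calc T j ≤ K ^ j ^ 2 * T j := le_mul_of_one_le_left' (one_le_pow₀ hK)
    _ ≤ max (K ^ 0 ^ 2 * T 0) (K ^ m ^ 2 * T m) := hS
    _ ≤ K ^ m ^ 2 * max (T 0) (T m) := by
      refine max_le ?_ ?_
      · gcongr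
        · omega
        · exact le_max_left _ _
      · gcongr
        exact le_max_right _ _

/-- Linear interpolation between `a` at `0` and `b` at `m`. -/
def linInterp (a b : ℝ) (m j : ℕ) : ℝ := a + j / m * (b - a)

theorem linInterp_mem_Ico {a b : ℝ} (ha : a ∈ Ico (0 : ℝ) 1) (hb : b ∈ Ico (0 : ℝ) 1) {m j : ℕ}
    (hj : j ≤ m) : linInterp a b m j ∈ Ico (0 : ℝ) 1 := by
  have h1 : (j : ℝ) / m ≤ 1 := div_le_one_of_le₀ (by exact_mod_cast hj) (by positivity)
  exact (convex_Ico (0 : ℝ) 1).add_smul_sub_mem ha hb ⟨by positivity, h1⟩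

theorem linInterp_midpoint (a b : ℝ) (m j : ℕ) :
    (linInterp a b m j + linInterp a b m (j + 2)) / 2 = linInterp a b m (j + 1) := by
  simp only [linInterp]
  push_cast
  ring

theorem eLpNorm_list_sum_le {X ι : Type*} [MeasurableSpace X] {μ : Measure X} {p : ℝ≥0∞}
    (hp : 1 ≤ p) {u : ι → X → ℝ} {B : ℝ≥0∞} (L : List ι)
    (hm : ∀ i ∈ L, AEStronglyMeasurable (u i) μ) (hB : ∀ i ∈ L, eLpNorm (u i) p μ ≤ B) :
    AEStronglyMeasurable (fun x => (L.map fun i => u i x).sum) μ ∧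
      eLpNorm (fun x => (L.map fun i => u i x).sum) p μ ≤ L.length * B := by
  induction L with
  | nil => simp [aestronglyMeasurable_const]
  | cons i L ih =>
    obtain ⟨h1, h2⟩ := ih (fun j hj => hm j (List.mem_cons_of_mem i hj))
      (fun j hj => hB j (List.mem_cons_of_mem i hj))
    simp only [List.map_cons, List.sum_cons, List.length_cons]
    refine ⟨(hm i List.mem_cons_self).add h1,
      (eLpNorm_add_le (hm i List.mem_cons_self) h1 hp).trans ?_⟩
    push_cast
    rw [add_mul, one_mul, add_comm]
    exact add_le_add h2 (hB i List.mem_cons_self)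

/-- Log-convexity of the products of derivative norms in the number of derivatives. -/
theorem exists_derivNorm_mul_derivNorm_le {a₁ a₂ a₃ a₄ : ℝ} (h1 : a₁ ∈ Ico (0 : ℝ) 1)
    (h2 : a₂ ∈ Ico (0 : ℝ) 1) (h3 : a₃ ∈ Ico (0 : ℝ) 1) (h4 : a₄ ∈ Ico (0 : ℝ) 1) (N m : ℕ) :
    ∃ K : ℝ≥0, 0 < K ∧ ∀ (f g : 𝓢(EN N, ℝ)) (j : ℕ), j ≤ m →
      derivNorm (j + 1) (ENNReal.ofReal (linInterp a₄ a₁ m j))⁻¹ f *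
          derivNorm (m - j) (ENNReal.ofReal (linInterp a₃ a₂ m j))⁻¹ g ≤
        K * max (derivNorm 1 (ENNReal.ofReal a₄)⁻¹ f * derivNorm m (ENNReal.ofReal a₃)⁻¹ g)
          (derivNorm (m + 1) (ENNReal.ofReal a₁)⁻¹ f * derivNorm 0 (ENNReal.ofReal a₂)⁻¹ g) := by
  set a := linInterp a₄ a₁ m
  set b := linInterp a₃ a₂ m
  have ha : ∀ {j}, j ≤ m → a j ∈ Ico (0 : ℝ) 1 := linInterp_mem_Ico h4 h1
  have hb : ∀ {j}, j ≤ m → b j ∈ Ico (0 : ℝ) 1 := linInterp_mem_Ico h3 h2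
  have hstep : ∀ j, ∃ C : ℝ≥0, j + 2 ≤ m → ∀ f g : 𝓢(EN N, ℝ),
      (derivNorm (j + 1 + 1) (ENNReal.ofReal (a (j + 1)))⁻¹ f *
        derivNorm (m - (j + 1)) (ENNReal.ofReal (b (j + 1)))⁻¹ g) ^ 2 ≤
      C * ((derivNorm (j + 1) (ENNReal.ofReal (a j))⁻¹ f *
        derivNorm (m - j) (ENNReal.ofReal (b j))⁻¹ g) *
        (derivNorm (j + 2 + 1) (ENNReal.ofReal (a (j + 2)))⁻¹ f *
        derivNorm (m - (j + 2)) (ENNReal.ofReal (b (j + 2)))⁻¹ g)) := by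
    intro j
    by_cases hj : j + 2 ≤ m
    swap
    · exact ⟨0, fun h => absurd h hj⟩
    obtain ⟨Cf, hCf⟩ := exists_derivNorm_sq_le (ha (j := j) (by omega)).1 (ha (by omega)).2
      (ha hj).1 (ha hj).2 (linInterp_midpoint a₄ a₁ m j)
    obtain ⟨Cg, hCg⟩ := exists_derivNorm_sq_le (hb hj).1 (hb hj).2
      (hb (j := j) (by omega)).1 (hb (by omega)).2
      ((congrArg (· / 2) (add_comm _ _)).trans (linInterp_midpoint a₃ a₂ m j))
    refine ⟨Cf * Cg, fun _ f g => ?_⟩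
    have hf := hCf N (j + 1) f
    have hg := hCg N (m - (j + 2)) g
    rw [show m - (j + 2) + 1 = m - (j + 1) by omega,
      show m - (j + 2) + 2 = m - j by omega] at hg
    rw [mul_pow]
    refine (mul_le_mul' hf hg).trans_eq ?_
    push_cast
    ring
  choose c hc using hstep
  set K : ℝ≥0 := 1 + ∑ j ∈ Finset.range m, c j
  have hcK : ∀ j, j + 2 ≤ m → c j ≤ K := fun j hj =>
    (Finset.single_le_sum (fun _ _ => zero_le) (Finset.mem_range.2 (by omega))).trans le_add_self
  have hK1 : 1 ≤ K := le_self_add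
  clear_value K
  refine ⟨K ^ m ^ 2, pow_pos (zero_lt_one.trans_le hK1) _, fun f g j hj => ?_⟩
  let T : ℕ → ℝ≥0∞ := fun j => derivNorm (j + 1) (ENNReal.ofReal (a j))⁻¹ f *
    derivNorm (m - j) (ENNReal.ofReal (b j))⁻¹ g
  have hTtop : ∀ j, T j < ⊤ := fun j =>
    ENNReal.mul_lt_top (derivNorm_lt_top _ _ f) (derivNorm_lt_top _ _ g)
  have hTsq : ∀ j, j + 2 ≤ m → T (j + 1) ^ 2 ≤ K * (T j * T (j + 2)) := fun j hj =>
    (hc j hj f g).trans (mul_le_mul' (ENNReal.coe_le_coe.2 (hcK j hj)) le_rfl)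
  have hT : T j ≤ K ^ m ^ 2 * max (T 0) (T m) :=
    le_mul_max_endpoints_of_sq_le_mul hTtop hK1 hTsq hj
  refine hT.trans ?_
  have hT0 : T 0 = derivNorm 1 (ENNReal.ofReal a₄)⁻¹ f * derivNorm m (ENNReal.ofReal a₃)⁻¹ g := by
    simp [T, a, b, linInterp]
  push_cast
  refine mul_le_mul' le_rfl (max_le (hT0.trans_le (le_max_left _ _)) ?_)
  rcases Nat.eq_zero_or_pos m with h0 | hpos
  · have : T m = T 0 := by rw [h0]
    exact (this.trans hT0).trans_le (le_max_left _ _)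
  have hm0 : (m : ℝ) ≠ 0 := by positivity
  have hTm : T m =
      derivNorm (m + 1) (ENNReal.ofReal a₁)⁻¹ f * derivNorm 0 (ENNReal.ofReal a₂)⁻¹ g := by
    simp [T, a, b, linInterp, hm0]
  exact hTm.trans_le (le_max_right _ _)

/-- **Commutator calculus inequality (Kato–Ponce type) in the whole space.**
For exponents `1 < s, s₁, s₃ < ∞` with `1/s = 1/s₁ + 1/s₂ = 1/s₃ + 1/s₄` and a
multi-index `α` with `|α| > 0`, there is `C = C(N, α, s, s₁, s₂, s₃, s₄)` such that for
all Schwartz functions `f, g`: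
`‖∂^α(fg) − f ∂^α g‖_{L^s} ≤ C (‖D^{|α|}f‖_{L^{s₁}} ‖g‖_{L^{s₂}} + ‖∇f‖_{L^{s₄}} ‖D^{|α|−1}g‖_{L^{s₃}})`. -/
theorem calculus_inequality_commutator
    (N : ℕ) (α : Fin N → ℕ) (hα : 0 < ∑ i, α i)
    (s s₁ s₂ s₃ s₄ : ℝ≥0∞)
    (hs : 1 < s) (hs' : s ≠ ⊤) (hs₁ : 1 < s₁) (hs₁' : s₁ ≠ ⊤)
    (hs₃ : 1 < s₃) (hs₃' : s₃ ≠ ⊤)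
    (h12 : 1 / s = 1 / s₁ + 1 / s₂) (h34 : 1 / s = 1 / s₃ + 1 / s₄) :
    ∃ C : ℝ≥0, 0 < C ∧
      ∀ f g : SchwartzMap (EN N) ℝ,
        eLpNorm (fun x => mpd α (fun z => f z * g z) x - f x * mpd α (⇑g) x) s volume ≤
          C * (eLpNorm (iteratedFDeriv ℝ (∑ i, α i) f) s₁ volume *
                eLpNorm (⇑g) s₂ volume +
              eLpNorm (fderiv ℝ (⇑f)) s₄ volume *
                eLpNorm (iteratedFDeriv ℝ ((∑ i, α i) - 1) g) s₃ volume) := by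
  rw [one_div, one_div, one_div] at h12 h34
  have hsinv : s⁻¹ < 1 := ENNReal.inv_lt_one.2 hs
  have hmem : ∀ r : ℝ≥0∞, r⁻¹ ≤ s⁻¹ →
      r⁻¹.toReal ∈ Ico (0 : ℝ) 1 ∧ ENNReal.ofReal r⁻¹.toReal = r⁻¹ := fun r hr =>
    ⟨⟨ENNReal.toReal_nonneg, by
      simpa using (ENNReal.toReal_lt_toReal (hr.trans_lt (hsinv.trans ENNReal.one_lt_top)).ne
        ENNReal.one_ne_top).2 (hr.trans_lt hsinv)⟩,
      ENNReal.ofReal_toReal (hr.trans_lt (hsinv.trans ENNReal.one_lt_top)).ne⟩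
  obtain ⟨h1, e1⟩ := hmem s₁ (h12 ▸ le_self_add)
  obtain ⟨h2, e2⟩ := hmem s₂ (h12 ▸ le_add_self)
  obtain ⟨h3, e3⟩ := hmem s₃ (h34 ▸ le_self_add)
  obtain ⟨h4, e4⟩ := hmem s₄ (h34 ▸ le_add_self)
  set a₁ := s₁⁻¹.toReal
  set a₂ := s₂⁻¹.toReal
  set a₃ := s₃⁻¹.toReal
  set a₄ := s₄⁻¹.toReal
  have hsum : a₁ + a₂ = a₃ + a₄ := by
    rw [← ENNReal.ofReal_eq_ofReal_iff (add_nonneg h1.1 h2.1) (add_nonneg h3.1 h4.1),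
      ENNReal.ofReal_add h1.1 h2.1, ENNReal.ofReal_add h3.1 h4.1, e1, e2, e3, e4, ← h12, ← h34]
  obtain ⟨m, hm⟩ : ∃ m, ∑ i, α i = m + 1 := ⟨_, (Nat.succ_pred_eq_of_pos hα).symm⟩
  rw [hm, Nat.add_sub_cancel]
  obtain ⟨l, hl, hmpd⟩ := exists_list_mpd_eq_foldr α
  obtain ⟨L, hL, hLeib⟩ := exists_foldr_pdN_mul_eq l
  set a := linInterp a₄ a₁ m
  set b := linInterp a₃ a₂ m
  have hab : ∀ {j}, j ≤ m → ENNReal.ofReal (a j) + ENNReal.ofReal (b j) = s⁻¹ := fun {j} hj => by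
    have : a j + b j = a₃ + a₄ := by
      simp only [a, b, linInterp]
      linear_combination (j / m : ℝ) * hsum
    rw [← ENNReal.ofReal_add (linInterp_mem_Ico h4 h1 hj).1 (linInterp_mem_Ico h3 h2 hj).1, this, ENNReal.ofReal_add h3.1 h4.1, e3, e4, h34]
  obtain ⟨K, hK0, hK⟩ := exists_derivNorm_mul_derivNorm_le h1 h2 h3 h4 N m
  simp only [e1, e2, e3, e4, inv_inv] at hK
  refine ⟨(L.length + 1) * K, by positivity, fun f g => ?_⟩
  set R := eLpNorm (iteratedFDeriv ℝ (m + 1) f) s₁ volume * eLpNorm (⇑g) s₂ volume +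
    eLpNorm (fderiv ℝ (⇑f)) s₄ volume * eLpNorm (iteratedFDeriv ℝ m g) s₃ volume
  have hmax : max (derivNorm 1 s₄ f * derivNorm m s₃ g) (derivNorm (m + 1) s₁ f *
      derivNorm 0 s₂ g) ≤ R := by
    refine max_le ((mul_le_mul' (derivNorm_one_le_eLpNorm_fderiv _ f)
      (derivNorm_le_eLpNorm_iteratedFDeriv _ _ g)).trans le_add_self) ?_
    rw [derivNorm_zero]
    exact (mul_le_mul' (derivNorm_le_eLpNorm_iteratedFDeriv _ _ f) le_rfl).trans le_self_add
  have hfun : (fun x => mpd α (fun z => f z * g z) x - f x * mpd α (⇑g) x) =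
      fun x => (L.map fun p => listDeriv p.1 f x * listDeriv p.2 g x).sum := by
    funext x
    rw [hmpd, hmpd, hLeib, foldr_pdN_schwartzMap]
    ring
  rw [hfun]
  refine (eLpNorm_list_sum_le (B := K * R) hs.le L (fun p _ =>
    ((listDeriv p.1 f).continuous.mul (listDeriv p.2 g).continuous).aestronglyMeasurable)
    fun p hp => ?_).2.trans ?_
  · obtain ⟨hp0, hp1⟩ := hL p hp
    obtain ⟨j, hj⟩ : ∃ j, p.1.length = j + 1 := ⟨_, (Nat.succ_pred_eq_of_pos hp0).symm⟩
    have hjm : j ≤ m := by omega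
    have hp2 : p.2.length = m - j := by omega
    have : ENNReal.HolderTriple (ENNReal.ofReal (a j))⁻¹ (ENNReal.ofReal (b j))⁻¹ s :=
      ⟨by rw [inv_inv, inv_inv, hab hjm]⟩
    refine (eLpNorm_le_eLpNorm_mul_eLpNorm_of_nnnorm (p := (ENNReal.ofReal (a j))⁻¹)
      (q := (ENNReal.ofReal (b j))⁻¹) (listDeriv p.1 f).continuous.aestronglyMeasurable
      (listDeriv p.2 g).continuous.aestronglyMeasurable (fun y z => y * z) 1
      (Eventually.of_forall fun x => by simp)).trans
      (le_trans ?_ ((hK f g j hjm).trans (by gcongr)))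
    rw [ENNReal.coe_one, one_mul]
    have hf := eLpNorm_listDeriv_le p.1 (ENNReal.ofReal (a j))⁻¹ f
    have hg := eLpNorm_listDeriv_le p.2 (ENNReal.ofReal (b j))⁻¹ g
    rw [hj] at hf
    rw [hp2] at hg
    exact mul_le_mul' hf hg
  · rw [← mul_assoc]
    push_cast
    gcongr
    exact le_self_add
end
end
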